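/- Concatenation of coordination codes: Let q(x¹, x², z¹, z², y¹, y²) be a pmf on finite sets whose (x¹,x²,y¹,y²)-marginal is q(x¹,x²,y¹,y²). If the rate pair (R₁₂, R₂₁) is admissible with r₁ interactive rounds for the coordination problem with sources (X¹, X²) and targets (Z¹, Z²) (i.e., for the marginal q(x¹,x²,z¹,z²)), and the rate pair (R'₁₂, R'₂₁) is admissible with r₂ interactive rounds for the coordination problem with sources ((X¹,Z¹), (X²,Z²)) and targets (Y¹, Y²) (i.e., for the marginal q((x¹,z¹),(x²,z²),y¹,y²)), then the rate pair (R₁₂ + R'₁₂, R₂₁ + R'₂₁) is admissible with r₁ + r₂ interactive rounds for the coordination problem with sources (X¹, X²) and targets (Y¹, Y²), i.e., for q(x¹,x²,y¹,y²). -/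

import Mathlib

open scoped BigOperators
open Finset

noncomputable section

namespace Coord

variable {Ω α β γ : Type*}

/-- `p` is a probability mass function on the finite type `α`. -/
def IsPMF [Fintype α] (p : α → ℝ) : Prop := (∀ a, 0 ≤ p a) ∧ ∑ a, p a = 1

/-- ℓ¹ (total variation) distance between two functions on a finite type. -/
def l1dist [Fintype α] (p q : α → ℝ) : ℝ := ∑ a, |p a - q a|

/-- The distribution (pushforward pmf) of the random variable `X` defined on the
finite sample space `Ω` carrying the pmf `μ`. -/
def distr [Fintype Ω] [DecidableEq α] (μ : Ω → ℝ) (X : Ω → α) : α → ℝ :=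
  fun a => ∑ ω, if X ω = a then μ ω else 0

/-- Shannon entropy (base 2) of a pmf. -/
def entFun [Fintype α] (p : α → ℝ) : ℝ := - ∑ a, p a * Real.logb 2 (p a)

/-- Shannon entropy `H(X)` of a random variable `X` on `(Ω, μ)`. -/
def H [Fintype Ω] [Fintype α] [DecidableEq α] (μ : Ω → ℝ) (X : Ω → α) : ℝ :=
  entFun (distr μ X)

/-- Conditional entropy `H(X | Z)`. -/
def condEnt [Fintype Ω] [Fintype α] [Fintype γ] [DecidableEq α] [DecidableEq γ]
    (μ : Ω → ℝ) (X : Ω → α) (Z : Ω → γ) : ℝ :=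
  H μ (fun ω => (X ω, Z ω)) - H μ Z

/-- Mutual information `I(X; Y)`. -/
def mi [Fintype Ω] [Fintype α] [Fintype β] [DecidableEq α] [DecidableEq β]
    (μ : Ω → ℝ) (X : Ω → α) (Y : Ω → β) : ℝ :=
  H μ X + H μ Y - H μ (fun ω => (X ω, Y ω))

/-- Conditional mutual information `I(X; Y | Z)`. -/
def cmi [Fintype Ω] [Fintype α] [Fintype β] [Fintype γ]
    [DecidableEq α] [DecidableEq β] [DecidableEq γ]
    (μ : Ω → ℝ) (X : Ω → α) (Y : Ω → β) (Z : Ω → γ) : ℝ :=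
  H μ (fun ω => (X ω, Z ω)) + H μ (fun ω => (Y ω, Z ω))
    - H μ (fun ω => (X ω, Y ω, Z ω)) - H μ Z

variable {𝒳₁ 𝒳₂ 𝒴₁ 𝒴₂ : Type}

/-- The `(x¹, x²)`-marginal of `q(x¹, x², y¹, y²)`. -/
def srcMarg [Fintype 𝒴₁] [Fintype 𝒴₂] (q : 𝒳₁ × 𝒳₂ × 𝒴₁ × 𝒴₂ → ℝ) :
    𝒳₁ × 𝒳₂ → ℝ := fun x => ∑ y₁, ∑ y₂, q (x.1, x.2, y₁, y₂)

/-- The rate pair `(R12, R21)` is admissible for the coordination problem `q` with `r`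
interactive rounds of communication: for every `ε > 0`, for all large enough block
lengths `n`, there is a finite probability space carrying the i.i.d. sources, private
randomness `M₁, M₂`, interactive messages `C i` (messages with even Lean-index,
i.e. odd 1-based index, are sent by the first node), and outputs `Y₁, Y₂`,
meeting the rate constraints and approximating the i.i.d. target distribution
within total variation `ε`. -/
def Admissible [Fintype 𝒳₁] [Fintype 𝒳₂] [Fintype 𝒴₁] [Fintype 𝒴₂]
    [DecidableEq 𝒳₁] [DecidableEq 𝒳₂] [DecidableEq 𝒴₁] [DecidableEq 𝒴₂]
    (q : 𝒳₁ × 𝒳₂ × 𝒴₁ × 𝒴₂ → ℝ) (r : ℕ) (R12 R21 : ℝ) : Prop :=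
  ∀ ε : ℝ, 0 < ε → ∃ n₀ : ℕ, ∀ n : ℕ, n₀ ≤ n →
    ∃ (Ω 𝓜₁ 𝓜₂ : Type) (𝓒 : Fin r → Type)
      (_ : Fintype Ω) (_ : DecidableEq Ω)
      (_ : Fintype 𝓜₁) (_ : DecidableEq 𝓜₁)
      (_ : Fintype 𝓜₂) (_ : DecidableEq 𝓜₂)
      (_ : ∀ i, Fintype (𝓒 i)) (_ : ∀ i, DecidableEq (𝓒 i))
      (μ : Ω → ℝ)
      (X₁ : Ω → Fin n → 𝒳₁) (X₂ : Ω → Fin n → 𝒳₂)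
      (M₁ : Ω → 𝓜₁) (M₂ : Ω → 𝓜₂)
      (C : (i : Fin r) → Ω → 𝓒 i)
      (Y₁ : Ω → Fin n → 𝒴₁) (Y₂ : Ω → Fin n → 𝒴₂),
      IsPMF μ ∧
      -- the source pairs are i.i.d. with per-letter distribution the (x¹,x²)-marginal of q
      (distr μ (fun ω => (X₁ ω, X₂ ω)) =
        fun x => ∏ k, srcMarg q (x.1 k, x.2 k)) ∧
      -- M₁, M₂ and the sources are mutually independent
      (distr μ (fun ω => (M₁ ω, M₂ ω, X₁ ω, X₂ ω)) =
        fun m => distr μ M₁ m.1 * distr μ M₂ m.2.1 *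
          distr μ (fun ω => (X₁ ω, X₂ ω)) m.2.2) ∧
      -- messages with odd 1-based index are functions of (previous messages, X¹, M₁)
      (∀ i : Fin r, (i : ℕ) % 2 = 0 →
        condEnt μ (C i)
          (fun ω => ((fun j : Fin (i : ℕ) => C ⟨j.1, j.2.trans i.2⟩ ω), X₁ ω, M₁ ω)) = 0) ∧
      -- messages with even 1-based index are functions of (previous messages, X², M₂)
      (∀ i : Fin r, (i : ℕ) % 2 = 1 →
        condEnt μ (C i)
          (fun ω => ((fun j : Fin (i : ℕ) => C ⟨j.1, j.2.trans i.2⟩ ω), X₂ ω, M₂ ω)) = 0) ∧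
      -- rate constraints
      (∑ i ∈ Finset.univ.filter (fun i : Fin r => (i : ℕ) % 2 = 0), H μ (C i)) ≤ n * R12 ∧
      (∑ i ∈ Finset.univ.filter (fun i : Fin r => (i : ℕ) % 2 = 1), H μ (C i)) ≤ n * R21 ∧
      -- the outputs are produced from the locally available information
      condEnt μ Y₁ (fun ω => (X₁ ω, M₁ ω, fun i : Fin r => C i ω)) = 0 ∧
      condEnt μ Y₂ (fun ω => (X₂ ω, M₂ ω, fun i : Fin r => C i ω)) = 0 ∧
      -- total variation distance to the i.i.d. target is at most ε
      l1dist (distr μ (fun ω => (X₁ ω, X₂ ω, Y₁ ω, Y₂ ω)))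
        (fun a => ∏ k, q (a.1 k, a.2.1 k, a.2.2.1 k, a.2.2.2 k)) ≤ ε

section Pushforward

lemma distr_nonneg [Fintype Ω] [DecidableEq α]
    {μ : Ω → ℝ} (hμ : ∀ ω, 0 ≤ μ ω) (X : Ω → α) (a : α) :
    0 ≤ distr μ X a :=
  Finset.sum_nonneg fun ω _ => by split_ifs <;> simp [hμ]

lemma sum_distr_mul [Fintype Ω] [Fintype α] [DecidableEq α] (μ : Ω → ℝ) (X : Ω → α) (g : α → ℝ) :
    ∑ a, distr μ X a * g a = ∑ ω, μ ω * g (X ω) := by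
  simp only [distr, Finset.sum_mul]
  rw [Finset.sum_comm]
  simp [ite_mul]

lemma sum_distr [Fintype Ω] [Fintype α] [DecidableEq α]
    (μ : Ω → ℝ) (X : Ω → α) : ∑ a, distr μ X a = ∑ ω, μ ω := by
  simpa using sum_distr_mul μ X 1

lemma IsPMF.distr [Fintype Ω] [Fintype α] [DecidableEq α]
    {μ : Ω → ℝ} (hμ : IsPMF μ) (X : Ω → α) : IsPMF (distr μ X) :=
  ⟨distr_nonneg hμ.1 X, by rw [sum_distr, hμ.2]⟩

lemma distr_distr [Fintype Ω] [Fintype α] [DecidableEq α] [DecidableEq β]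
    (μ : Ω → ℝ) (X : Ω → α) (f : α → β) :
    distr (distr μ X) f = distr μ (fun ω => f (X ω)) := by
  funext b
  have := sum_distr_mul μ X (fun a => if f a = b then 1 else 0)
  simpa [Coord.distr] using this

lemma distr_comp_injective [Fintype Ω] [DecidableEq α] [DecidableEq β]
    (μ : Ω → ℝ) (X : Ω → α) {e : α → β} (he : Function.Injective e)
    (a : α) : distr μ (fun ω => e (X ω)) (e a) = distr μ X a := by
  simp [distr, he.eq_iff]

lemma distr_congr [Fintype Ω] [DecidableEq α]
    {μ : Ω → ℝ} {X Y : Ω → α} (h : ∀ ω, μ ω ≠ 0 → X ω = Y ω) :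
    distr μ X = distr μ Y := by
  funext a
  refine Finset.sum_congr rfl fun ω _ => ?_
  by_cases h0 : μ ω = 0
  · simp [h0]
  · rw [h ω h0]

lemma le_distr [Fintype Ω] [DecidableEq α] {μ : Ω → ℝ} (hμ : ∀ ω, 0 ≤ μ ω) (X : Ω → α) (ω : Ω) :
    μ ω ≤ distr μ X (X ω) := by
  have := Finset.single_le_sum (f := fun ω' => if X ω' = X ω then μ ω' else 0)
    (fun ω' _ => by split_ifs <;> simp [hμ]) (Finset.mem_univ ω)
  simpa [distr] using this

lemma distr_pos [Fintype Ω] [DecidableEq α]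
    {μ : Ω → ℝ} (hμ : ∀ ω, 0 ≤ μ ω) (X : Ω → α) {ω : Ω} (h : μ ω ≠ 0) :
    0 < distr μ X (X ω) :=
  (lt_of_le_of_ne (hμ ω) h.symm).trans_le (le_distr hμ X ω)

lemma distr_le_one [Fintype Ω] [Fintype α] [DecidableEq α]
    {μ : Ω → ℝ} (hμ : IsPMF μ) (X : Ω → α) (a : α) : distr μ X a ≤ 1 := by
  rw [← (hμ.distr X).2]
  exact Finset.single_le_sum (fun b _ => (hμ.distr X).1 b) (Finset.mem_univ a)

lemma distr_ne_zero [Fintype Ω] [DecidableEq α]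
    {μ : Ω → ℝ} {X : Ω → α} {a : α} (h : distr μ X a ≠ 0) :
    ∃ ω, μ ω ≠ 0 ∧ X ω = a := by
  obtain ⟨ω, -, hω⟩ := Finset.exists_ne_zero_of_sum_ne_zero h
  by_cases hX : X ω = a
  · exact ⟨ω, by simpa [hX] using hω, hX⟩
  · simp [hX] at hω

lemma sum_filter_distr [Fintype Ω] [Fintype α] [DecidableEq α]
    (μ : Ω → ℝ) (X : Ω → α) (p : α → Prop) [DecidablePred p] :
    ∑ a with p a, distr μ X a = ∑ ω with p (X ω), μ ω := by
  have := sum_distr_mul μ X (fun a => if p a then 1 else 0)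
  simpa [Finset.sum_filter] using this

lemma l1dist_triangle [Fintype α] (p q r : α → ℝ) : l1dist p r ≤ l1dist p q + l1dist q r := by
  rw [l1dist, l1dist, l1dist, ← Finset.sum_add_distrib]
  exact Finset.sum_le_sum fun a _ => abs_sub_le _ _ _

lemma l1dist_distr_le [Fintype α] [Fintype β] [DecidableEq β] (p q : α → ℝ) (f : α → β) :
    l1dist (distr p f) (distr q f) ≤ l1dist p q := by
  calc l1dist (distr p f) (distr q f)
      ≤ ∑ b, ∑ a, (if f a = b then |p a - q a| else 0) := by
        refine Finset.sum_le_sum fun b _ => ?_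
        rw [distr, distr, ← Finset.sum_sub_distrib]
        refine (Finset.abs_sum_le_sum_abs _ _).trans (Finset.sum_le_sum fun a _ => ?_)
        split_ifs <;> simp
    _ = l1dist p q := sum_distr (fun a => |p a - q a|) f

lemma l1dist_prod_right [Fintype α] [Fintype β] (p q : α → ℝ) {ρ : β → ℝ} (hρ : IsPMF ρ) :
    l1dist (fun x : α × β => p x.1 * ρ x.2) (fun x => q x.1 * ρ x.2) = l1dist p q := by
  simp only [l1dist, Fintype.sum_prod_type, ← sub_mul, abs_mul]
  simp only [← Finset.mul_sum, abs_of_nonneg (hρ.1 _), hρ.2, mul_one]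

lemma IsPMF.prod [Fintype α] [Fintype β] {p : α → ℝ} {ρ : β → ℝ} (hp : IsPMF p) (hρ : IsPMF ρ) :
    IsPMF (fun x : α × β => p x.1 * ρ x.2) :=
  ⟨fun x => mul_nonneg (hp.1 _) (hρ.1 _), by
    simp [Fintype.sum_prod_type, ← Finset.mul_sum, hp.2, hρ.2]⟩

lemma distr_prodMap [Fintype Ω] [DecidableEq α] [DecidableEq β]
    {Ω' : Type*} [Fintype Ω'] (μ : Ω → ℝ) (ρ : Ω' → ℝ) (F : Ω → α)
    (G : Ω' → β) :
    distr (fun x : Ω × Ω' => μ x.1 * ρ x.2) (fun x => (F x.1, G x.2)) =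
      fun y => distr μ F y.1 * distr ρ G y.2 := by
  funext y
  simp only [distr, Fintype.sum_prod_type, Finset.sum_mul_sum, ite_mul, mul_ite, zero_mul,
    mul_zero, Prod.ext_iff, ite_and]
  refine Finset.sum_congr rfl fun a _ => Finset.sum_congr rfl fun b _ => ?_
  split_ifs <;> rfl

lemma distr_fst [Fintype Ω] [DecidableEq α]
    {Ω' : Type*} [Fintype Ω'] (μ : Ω → ℝ) {ρ : Ω' → ℝ} (hρ : IsPMF ρ) (F : Ω → α) :
    distr (fun x : Ω × Ω' => μ x.1 * ρ x.2) (fun x => F x.1) = distr μ F := by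
  funext a
  simp only [distr, Fintype.sum_prod_type]
  refine Finset.sum_congr rfl fun ω _ => ?_
  split_ifs <;> simp [← Finset.mul_sum, hρ.2]

lemma distr_snd [Fintype Ω] [DecidableEq β]
    {Ω' : Type*} [Fintype Ω'] {μ : Ω → ℝ} (hμ : IsPMF μ) (ρ : Ω' → ℝ) (G : Ω' → β) :
    distr (fun x : Ω × Ω' => μ x.1 * ρ x.2) (fun x => G x.2) = distr ρ G := by
  funext a
  simp only [distr, Fintype.sum_prod_type]
  rw [Finset.sum_comm]
  refine Finset.sum_congr rfl fun ω _ => ?_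
  split_ifs <;> simp [← Finset.sum_mul, hμ.2]

lemma distr_id [Fintype α] [DecidableEq α] (μ : α → ℝ) : distr μ (fun a => a) = μ := by
  funext a
  simp [distr]

/-- Two random variables that agree outside an event have laws at distance at most twice the
probability of the event. -/
lemma l1dist_distr_le_of_eq_off [Fintype Ω] [Fintype α] [DecidableEq α]
    {μ : Ω → ℝ} (hμ : ∀ ω, 0 ≤ μ ω) {X Y : Ω → α}
    (E : Ω → Prop) [DecidablePred E] (h : ∀ ω, ¬ E ω → X ω = Y ω) :
    l1dist (distr μ X) (distr μ Y) ≤ 2 * ∑ ω with E ω, μ ω := by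
  set ν : Ω → ℝ := fun ω => if E ω then μ ω else 0
  calc l1dist (distr μ X) (distr μ Y)
      ≤ ∑ a, (distr ν X a + distr ν Y a) := by
        refine Finset.sum_le_sum fun a _ => ?_
        simp only [distr]
        rw [← Finset.sum_sub_distrib, ← Finset.sum_add_distrib]
        refine (Finset.abs_sum_le_sum_abs _ _).trans (Finset.sum_le_sum fun ω _ => ?_)
        by_cases hE : E ω
        · have := hμ ω
          simp only [ν, hE, if_true]
          split_ifs <;> simp [abs_of_nonneg this, this]
        · simp [h ω hE, ν, hE]
    _ = 2 * ∑ ω with E ω, μ ω := by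
        rw [Finset.sum_add_distrib, sum_distr, sum_distr, Finset.sum_filter]
        ring

end Pushforward

section Entropy

lemma H_eq_sum [Fintype Ω] [Fintype α] [DecidableEq α] (μ : Ω → ℝ) (X : Ω → α) :
    H μ X = -∑ ω, μ ω * Real.logb 2 (distr μ X (X ω)) := by
  rw [H, entFun, sum_distr_mul μ X (fun a => Real.logb 2 (distr μ X a))]

lemma H_nonneg [Fintype Ω] [Fintype α] [DecidableEq α]
    {μ : Ω → ℝ} (hμ : IsPMF μ) (X : Ω → α) : 0 ≤ H μ X := by
  rw [H_eq_sum, Left.nonneg_neg_iff]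
  refine Finset.sum_nonpos fun ω _ => mul_nonpos_of_nonneg_of_nonpos (hμ.1 ω) ?_
  exact Real.logb_nonpos (by norm_num) (distr_nonneg hμ.1 _ _) (distr_le_one hμ _ _)

lemma H_comp_injective [Fintype Ω] [Fintype α] [DecidableEq α] [Fintype β] [DecidableEq β]
    (μ : Ω → ℝ) (X : Ω → α) {e : α → β} (he : Function.Injective e) :
    H μ (fun ω => e (X ω)) = H μ X := by
  simp only [H_eq_sum, distr_comp_injective μ X he]

lemma H_const [Fintype Ω] [Fintype α] [DecidableEq α]
    {μ : Ω → ℝ} (hμ : IsPMF μ) (a : α) : H μ (fun _ => a) = 0 := by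
  rw [H_eq_sum]
  simp [distr, hμ.2]

lemma H_distr [Fintype Ω] [Fintype α] [DecidableEq α] [Fintype β] [DecidableEq β]
    (μ : Ω → ℝ) (X : Ω → α) (f : α → β) :
    H (distr μ X) f = H μ (fun ω => f (X ω)) := by
  rw [H, H, distr_distr]

lemma H_congr [Fintype Ω] [Fintype α] [DecidableEq α]
    {μ : Ω → ℝ} {X Y : Ω → α} (h : ∀ ω, μ ω ≠ 0 → X ω = Y ω) : H μ X = H μ Y := by
  rw [H, H, distr_congr h]

/-- Gibbs' inequality. -/
lemma entFun_le_cross [Fintype α]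
    {a b : α → ℝ} (ha : IsPMF a) (hb : ∀ i, 0 ≤ b i) (hb1 : ∑ i, b i ≤ 1)
    (hab : ∀ i, b i = 0 → a i = 0) : entFun a ≤ -∑ i, a i * Real.logb 2 (b i) := by
  have key : ∀ i, a i * (Real.log (b i) - Real.log (a i)) ≤ b i - a i := by
    intro i
    rcases (ha.1 i).eq_or_lt with h0 | hpos
    · simp [← h0, hb i]
    · have hbi : 0 < b i := lt_of_le_of_ne (hb i) fun h => hpos.ne' (hab i h.symm)
      rw [← Real.log_div hbi.ne' hpos.ne']
      have := mul_le_mul_of_nonneg_left (Real.log_le_sub_one_of_pos (div_pos hbi hpos)) hpos.le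
      refine this.trans_eq ?_
      field_simp
  have hsum : ∑ i, a i * (Real.log (b i) - Real.log (a i)) ≤ 0 := by
    refine (Finset.sum_le_sum fun i _ => key i).trans ?_
    rw [Finset.sum_sub_distrib, ha.2]
    linarith
  rw [entFun, neg_le_neg_iff, ← sub_nonpos, ← Finset.sum_sub_distrib]
  have hlog : 0 < Real.log 2 := Real.log_pos (by norm_num)
  have : ∑ i, (a i * Real.logb 2 (b i) - a i * Real.logb 2 (a i)) =
      (∑ i, a i * (Real.log (b i) - Real.log (a i))) / Real.log 2 := by
    rw [Finset.sum_div]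
    refine Finset.sum_congr rfl fun i _ => ?_
    simp only [Real.logb]
    ring
  rw [this]
  exact div_nonpos_of_nonpos_of_nonneg hsum hlog.le

lemma H_pair_le [Fintype Ω] [Fintype α] [DecidableEq α] [Fintype β] [DecidableEq β]
    {μ : Ω → ℝ} (hμ : IsPMF μ) (X : Ω → α) (Y : Ω → β) :
    H μ (fun ω => (X ω, Y ω)) ≤ H μ X + H μ Y := by
  have hX := hμ.distr X
  have hY := hμ.distr Y
  have hprod := hX.prod hY
  have hdom : ∀ ω, μ ω ≠ 0 → distr μ X (X ω) ≠ 0 ∧ distr μ Y (Y ω) ≠ 0 := fun ω h =>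
    ⟨(distr_pos hμ.1 X h).ne', (distr_pos hμ.1 Y h).ne'⟩
  refine (entFun_le_cross (hμ.distr _) hprod.1 hprod.2.le ?_).trans_eq ?_
  · rintro ⟨a, b⟩ h0
    by_contra hne
    obtain ⟨ω, hω, he⟩ := distr_ne_zero hne
    simp only [Prod.mk.injEq] at he
    obtain ⟨h1, h2⟩ := hdom ω hω
    rw [he.1] at h1
    rw [he.2] at h2
    exact (mul_ne_zero h1 h2) h0
  · rw [sum_distr_mul μ (fun ω => (X ω, Y ω))
      (fun c => Real.logb 2 (distr μ X c.1 * distr μ Y c.2)), H_eq_sum, H_eq_sum, ← neg_add,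
      ← Finset.sum_add_distrib]
    congr 1
    refine Finset.sum_congr rfl fun ω _ => ?_
    by_cases h0 : μ ω = 0
    · simp [h0]
    · rw [Real.logb_mul (hdom ω h0).1 (hdom ω h0).2, mul_add]

/-- `H(X | Z) = 0` exactly when `X` is almost surely a function of `Z`. -/
lemma condEnt_eq_zero_iff [Fintype Ω] [Fintype α] [DecidableEq α] [Fintype γ] [DecidableEq γ]
    {μ : Ω → ℝ} (hμ : IsPMF μ) (X : Ω → α) (Z : Ω → γ) :
    condEnt μ X Z = 0 ↔
      ∀ ω ω', μ ω ≠ 0 → μ ω' ≠ 0 → Z ω = Z ω' → X ω = X ω' := by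
  set d := fun ω => distr μ (fun ω => (X ω, Z ω)) (X ω, Z ω)
  have hle : ∀ ω, d ω ≤ distr μ Z (Z ω) := fun ω =>
    Finset.sum_le_sum fun ω' _ => by
      have := hμ.1 ω'
      by_cases h : Z ω' = Z ω <;> by_cases h' : X ω' = X ω <;> simp [h, h', this]
  have hdpos : ∀ ω, μ ω ≠ 0 → 0 < d ω := fun ω h => distr_pos hμ.1 (fun ω => (X ω, Z ω)) h
  have hform : condEnt μ X Z =
      ∑ ω, μ ω * (Real.logb 2 (distr μ Z (Z ω)) - Real.logb 2 (d ω)) := by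
    rw [condEnt, H_eq_sum, H_eq_sum]
    simp only [mul_sub, Finset.sum_sub_distrib]
    ring
  have hterm : ∀ ω ∈ Finset.univ,
      0 ≤ μ ω * (Real.logb 2 (distr μ Z (Z ω)) - Real.logb 2 (d ω)) := by
    intro ω _
    by_cases h0 : μ ω = 0
    · simp [h0]
    · exact mul_nonneg (hμ.1 ω) (sub_nonneg.2
        (Real.logb_le_logb_of_le (by norm_num) (hdpos ω h0) (hle ω)))
  rw [hform, Finset.sum_eq_zero_iff_of_nonneg hterm]
  constructor
  · intro h ω ω' hω hω' hZ
    by_contra hX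
    have h1 := h ω (Finset.mem_univ _)
    rw [mul_eq_zero, or_iff_right hω, sub_eq_zero] at h1
    have h2 : distr μ Z (Z ω) = d ω :=
      Real.logb_injOn_pos (by norm_num) ((hdpos ω hω).trans_le (hle ω)) (hdpos ω hω) h1
    have h3 : d ω < distr μ Z (Z ω) := by
      refine Finset.sum_lt_sum (fun ω' _ => ?_) ⟨ω', Finset.mem_univ _, ?_⟩
      · have := hμ.1 ω'
        by_cases h : Z ω' = Z ω <;> by_cases h' : X ω' = X ω <;> simp [h, h', this]
      · simpa [hZ, Ne.symm hX] using lt_of_le_of_ne (hμ.1 ω') hω'.symm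
    exact h3.ne' h2
  · intro h ω _
    by_cases h0 : μ ω = 0
    · simp [h0]
    · have : d ω = distr μ Z (Z ω) := by
        refine Finset.sum_congr rfl fun ω' _ => ?_
        by_cases h0' : μ ω' = 0
        · simp [h0']
        · by_cases hz : Z ω' = Z ω
          · simp [hz, h ω' ω h0' h0 hz]
          · simp [hz]
      rw [this, sub_self, mul_zero]

lemma eq_of_H_eq_zero [Fintype Ω] [Fintype α] [DecidableEq α]
    {μ : Ω → ℝ} (hμ : IsPMF μ) {X : Ω → α} (h : H μ X = 0) {ω ω' : Ω}
    (hω : μ ω ≠ 0) (hω' : μ ω' ≠ 0) : X ω = X ω' := by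
  refine (condEnt_eq_zero_iff hμ X (fun _ => ())).1 ?_ ω ω' hω hω' rfl
  have he : Function.Injective fun a : α => (a, ()) := fun a b hab => (Prod.ext_iff.1 hab).1
  rw [condEnt, H_const hμ, sub_zero, H_comp_injective μ X he, h]

end Entropy

section Truncation

/-- Small atoms of total mass at most one can be distributed over `k` classes of mass at
most `2 / k` each. -/
lemma exists_balanced_coloring [DecidableEq α] {p : α → ℝ} (hp : ∀ a, 0 ≤ p a) {k : ℕ}
    (hk : 0 < k) (s : Finset α) (hsmall : ∀ a ∈ s, p a ≤ 1 / k) (hs : ∑ a ∈ s, p a ≤ 1) :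
    ∃ χ : α → Fin k, ∀ j, ∑ a ∈ s with χ a = j, p a ≤ 2 / k := by
  have : NeZero k := ⟨hk.ne'⟩
  have hk' : (0 : ℝ) < k := by exact_mod_cast hk
  induction s using Finset.induction_on with
  | empty => exact ⟨fun _ => 0, fun j => by simpa using by positivity⟩
  | insert a s ha ih =>
    rw [Finset.sum_insert ha] at hs
    have hs' : ∑ b ∈ s, p b ≤ 1 := by linarith [hp a]
    obtain ⟨χ, hχ⟩ := ih (fun b hb => hsmall b (Finset.mem_insert_of_mem hb)) hs'
    obtain ⟨j, -, hj⟩ : ∃ j ∈ (Finset.univ : Finset (Fin k)),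
        ∑ b ∈ s with χ b = j, p b ≤ 1 / k := by
      refine Finset.exists_le_of_sum_le Finset.univ_nonempty ?_
      rw [Finset.sum_fiberwise, Finset.sum_const, Finset.card_univ, Fintype.card_fin,
        nsmul_eq_mul, mul_one_div_cancel hk'.ne']
      exact hs'
    have hagree : ∀ i, {b ∈ s | Function.update χ a j b = i} = {b ∈ s | χ b = i} := fun i =>
      Finset.filter_congr fun b hb => by
        have hne : b ≠ a := fun h => ha (h ▸ hb)
        rw [Function.update_of_ne hne]
    refine ⟨Function.update χ a j, fun i => ?_⟩
    rw [Finset.filter_insert, hagree, Function.update_self]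
    split_ifs with h
    · subst h
      rw [Finset.sum_insert (by simp [ha])]
      calc p a + ∑ b ∈ s with χ b = j, p b ≤ 1 / k + 1 / k :=
            add_le_add (hsmall a (Finset.mem_insert_self a s)) hj
        _ = 2 / k := by ring
    · exact hχ i

/-- An event of probability at most `2 / k` whose removal saves a fraction `1 / k` of the
entropy, up to an additive constant. -/
lemma exists_small_event_saving_entropy [Fintype α] [DecidableEq α] {p : α → ℝ} (hp : IsPMF p) {k : ℕ}
    (hk : 0 < k) :
    ∃ S : Finset α, ∑ a ∈ S, p a ≤ 2 / k ∧
      ∑ a ∈ Sᶜ, -(p a * Real.logb 2 (p a)) ≤ Real.logb 2 k + (1 - 1 / k) * entFun p := by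
  have hk' : (0 : ℝ) < k := by exact_mod_cast hk
  have hk1 : (1 : ℝ) ≤ k := by exact_mod_cast hk
  have hle1 : ∀ a, p a ≤ 1 := fun a => by
    rw [← hp.2]
    exact Finset.single_le_sum (fun b _ => hp.1 b) (Finset.mem_univ a)
  set w : α → ℝ := fun a => -(p a * Real.logb 2 (p a))
  have hw : ∀ a, 0 ≤ w a := fun a => Left.nonneg_neg_iff.2
    (mul_nonpos_of_nonneg_of_nonpos (hp.1 a) (Real.logb_nonpos (by norm_num) (hp.1 a) (hle1 a)))
  set s : Finset α := {a | p a ≤ 1 / k}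
  obtain ⟨χ, hχ⟩ := exists_balanced_coloring hp.1 hk s (fun a ha => by simpa [s] using ha)
    ((Finset.sum_le_univ_sum_of_nonneg hp.1).trans_eq hp.2)
  have : NeZero k := ⟨hk.ne'⟩
  obtain ⟨j, -, hj⟩ : ∃ j ∈ (Finset.univ : Finset (Fin k)),
      (∑ a ∈ s, w a) / k ≤ ∑ a ∈ s with χ a = j, w a := by
    refine Finset.exists_le_of_sum_le Finset.univ_nonempty ?_
    rw [Finset.sum_fiberwise, Finset.sum_const, Finset.card_univ, Fintype.card_fin,
      nsmul_eq_mul, mul_div_cancel₀ _ hk'.ne']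
  refine ⟨{a ∈ s | χ a = j}, hχ j, ?_⟩
  have hW : entFun p = ∑ a, w a := by simp [entFun, w, Finset.sum_neg_distrib]
  have hsplit := Finset.sum_add_sum_compl {a ∈ s | χ a = j} w
  have hsplit' := Finset.sum_add_sum_compl s w
  have hbig : ∑ a ∈ sᶜ, w a ≤ Real.logb 2 k := by
    calc ∑ a ∈ sᶜ, w a ≤ ∑ a ∈ sᶜ, p a * Real.logb 2 k := by
          refine Finset.sum_le_sum fun a ha => ?_
          have ha' : (k : ℝ)⁻¹ < p a := by simpa [s] using ha
          have := Real.logb_le_logb_of_le (b := 2) (by norm_num) (by positivity) ha'.le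
          rw [Real.logb_inv] at this
          simp only [w, ← mul_neg]
          exact mul_le_mul_of_nonneg_left (by linarith) (hp.1 a)
      _ ≤ 1 * Real.logb 2 k := by
          rw [← Finset.sum_mul]
          refine mul_le_mul_of_nonneg_right ?_ (Real.logb_nonneg (by norm_num) hk1)
          exact (Finset.sum_le_univ_sum_of_nonneg hp.1).trans_eq hp.2
      _ = Real.logb 2 k := one_mul _
  have hdiv : (∑ a ∈ sᶜ, w a) / k ≤ ∑ a ∈ sᶜ, w a :=
    div_le_self (Finset.sum_nonneg fun a _ => hw a) hk1
  have : (∑ a, w a) / k = (∑ a ∈ s, w a) / k + (∑ a ∈ sᶜ, w a) / k := by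
    rw [← hsplit', add_div]
  rw [hW, sub_mul, one_mul, one_div_mul_eq_div]
  linarith

/-- A message with law `p'` close to `p` can be erased on an event of small probability so that
the entropy of the result is smaller than that of `p` by a constant factor, up to an additive
constant. -/
lemma exists_erasure_event [Fintype α] [DecidableEq α] {p p' : α → ℝ} (hp : IsPMF p) {ε : ℝ}
    (hd : l1dist p' p ≤ ε) {k : ℕ} (hk : 0 < k) :
    ∃ B : Finset α, ∑ a ∈ B, p' a ≤ 2 / k + (2 + 2 * k) * ε ∧
      ∀ c : Option α → ℝ, IsPMF c → (∀ a, c (some a) ≤ p' a) → (∀ a ∈ B, c (some a) = 0) →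
        entFun c ≤ 1 + 2 * Real.logb 2 k + (1 - 1 / (2 * k)) * entFun p := by
  have hk' : (0 : ℝ) < k := by exact_mod_cast hk
  have hk1 : (1 : ℝ) ≤ k := by exact_mod_cast hk
  have hdist : ∀ s : Finset α, ∑ a ∈ s, |p' a - p a| ≤ ε := fun s =>
    (Finset.sum_le_univ_sum_of_nonneg fun a => abs_nonneg _).trans hd
  obtain ⟨S, hS, hSent⟩ := exists_small_event_saving_entropy hp hk
  set U : Finset α := {a | (1 + 1 / (2 * k)) * p a < p' a}
  have hSU : ∑ a ∈ S ∪ U, p' a ≤ ∑ a ∈ S, p' a + ∑ a ∈ U, p' a := by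
    rw [← Finset.sum_union_inter]
    refine le_add_of_nonneg_right (Finset.sum_nonneg fun a ha => ?_)
    have : (1 + 1 / (2 * k)) * p a < p' a := by simpa [U] using (Finset.mem_inter.1 ha).2
    exact (mul_nonneg (by positivity) (hp.1 a)).trans this.le
  refine ⟨S ∪ U, hSU.trans ?_, fun c hc hcp hcB => ?_⟩
  · have h1 : ∑ a ∈ S, p' a ≤ 2 / k + ε := by
      calc ∑ a ∈ S, p' a ≤ ∑ a ∈ S, (p a + |p' a - p a|) :=
            Finset.sum_le_sum fun a _ => by linarith [le_abs_self (p' a - p a)]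
        _ ≤ 2 / k + ε := by
            rw [Finset.sum_add_distrib]
            exact add_le_add hS (hdist S)
    have h2 : ∑ a ∈ U, p' a ≤ (1 + 2 * k) * ε := by
      calc ∑ a ∈ U, p' a ≤ ∑ a ∈ U, (1 + 2 * k) * |p' a - p a| := by
            refine Finset.sum_le_sum fun a ha => ?_
            have ha' : (1 + 1 / (2 * k)) * p a < p' a := by simpa [U] using ha
            have h3 : p a < 2 * k * (p' a - p a) := by
              have : 2 * k * ((1 + 1 / (2 * k)) * p a) = 2 * k * p a + p a := by
                field_simp
              have := mul_lt_mul_of_pos_left ha' (by positivity : (0 : ℝ) < 2 * k)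
              linarith
            have h4 := mul_le_mul_of_nonneg_left (le_abs_self (p' a - p a))
              (by positivity : (0 : ℝ) ≤ 1 + 2 * k)
            linarith
        _ ≤ (1 + 2 * k) * ε := by
            rw [← Finset.mul_sum]
            exact mul_le_mul_of_nonneg_left (hdist U) (by positivity)
    linarith
  · have hcle : ∀ a, c (some a) ≤ (1 + 1 / (2 * k)) * p a := by
      intro a
      by_cases ha : a ∈ S ∪ U
      · rw [hcB a ha]
        exact mul_nonneg (by positivity) (hp.1 a)
      · have ha' : p' a ≤ (1 + 1 / (2 * k)) * p a := by
          simp only [Finset.mem_union, not_or, U, Finset.mem_filter, Finset.mem_univ, true_and,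
            not_lt] at ha
          exact ha.2
        exact (hcp a).trans ha'
    have hle1 : ∀ a, p a ≤ 1 := fun a => by
      rw [← hp.2]
      exact Finset.single_le_sum (fun b _ => hp.1 b) (Finset.mem_univ a)
    have hlog : ∀ a, Real.logb 2 (p a) ≤ 0 := fun a =>
      Real.logb_nonpos (by norm_num) (hp.1 a) (hle1 a)
    have hzero : ∀ a, p a = 0 → c (some a) = 0 := fun a ha =>
      le_antisymm (by simpa [ha] using hcle a) (hc.1 _)
    set b : Option α → ℝ := fun o => o.elim (1 / 2) fun a => p a / 2
    have hb1 : ∑ o, b o = 1 := by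
      rw [Fintype.sum_option]
      simp only [b, Option.elim, ← Finset.sum_div, hp.2]
      norm_num
    have hgibbs := entFun_le_cross hc (b := b)
      (fun o => by cases o with
        | none => simp [b]
        | some a => exact div_nonneg (hp.1 a) zero_le_two) hb1.le
      (fun o ho => by cases o <;> simp_all [b])
    have hcsum : c none + ∑ a, c (some a) = 1 := by rw [← Fintype.sum_option, hc.2]
    have hcross : -∑ o, c o * Real.logb 2 (b o) =
        1 + ∑ a, c (some a) * -Real.logb 2 (p a) := by
      have hterm : ∀ a, c (some a) * Real.logb 2 (p a / 2) =
          -c (some a) - c (some a) * -Real.logb 2 (p a) := by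
        intro a
        by_cases ha : p a = 0
        · simp [hzero a ha]
        · rw [Real.logb_div ha (by norm_num), Real.logb_self_eq_one (by norm_num)]
          ring
      rw [Fintype.sum_option]
      simp only [b, Option.elim, hterm]
      rw [Finset.sum_sub_distrib, Finset.sum_neg_distrib, one_div, Real.logb_inv,
        Real.logb_self_eq_one (by norm_num)]
      linarith
    have hsub : ∑ a, c (some a) * -Real.logb 2 (p a) ≤
        (1 + 1 / (2 * k)) * ∑ a ∈ Sᶜ, -(p a * Real.logb 2 (p a)) := by
      rw [Finset.mul_sum, ← Finset.sum_add_sum_compl S,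
        Finset.sum_eq_zero (s := S) fun a ha => by
          rw [hcB a (Finset.mem_union_left _ ha), zero_mul], zero_add]
      refine Finset.sum_le_sum fun a _ => ?_
      have := mul_le_mul_of_nonneg_right (hcle a) (neg_nonneg.2 (hlog a))
      linarith
    have hent : 0 ≤ entFun p := by
      rw [entFun, Left.nonneg_neg_iff]
      exact Finset.sum_nonpos fun a _ => mul_nonpos_of_nonneg_of_nonpos (hp.1 a) (hlog a)
    have hlogk : 0 ≤ Real.logb 2 k := Real.logb_nonneg (by norm_num) hk1
    set x : ℝ := 1 / (2 * k)
    have hx0 : 0 ≤ x := by positivity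
    have hx1 : x ≤ 1 := by
      simp only [x]
      rw [div_le_one (by positivity)]
      linarith
    have hkx : 1 / (k : ℝ) = 2 * x := by simp only [x]; field_simp
    rw [hkx] at hSent
    have h5 := mul_le_mul_of_nonneg_left hSent (by linarith : 0 ≤ 1 + x)
    nlinarith [mul_nonneg (mul_nonneg hx0 hx0) hent, mul_nonneg (sub_nonneg.2 hx1) hlogk]

end Truncation

section Transcript

variable {T D₁ D₂ : Type*}

/-- The transcript, latest message first, of the first `i` rounds of the protocol in which the
nodes with local information `d₁` and `d₂` take turns applying `f₁` and `f₂`. -/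
def transcript (f₁ : List T → D₁ → T) (f₂ : List T → D₂ → T) (d₁ : D₁) (d₂ : D₂) : ℕ → List T
  | 0 => []
  | i + 1 => (if i % 2 = 0 then f₁ (transcript f₁ f₂ d₁ d₂ i) d₁
      else f₂ (transcript f₁ f₂ d₁ d₂ i) d₂) :: transcript f₁ f₂ d₁ d₂ i

/-- The message with index `i` of the protocol. -/
def message (f₁ : List T → D₁ → T) (f₂ : List T → D₂ → T) (i : ℕ) (d : D₁ × D₂) : T :=
  if i % 2 = 0 then f₁ (transcript f₁ f₂ d.1 d.2 i) d.1 else f₂ (transcript f₁ f₂ d.1 d.2 i) d.2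

lemma transcript_succ (f₁ : List T → D₁ → T) (f₂ : List T → D₂ → T) (d : D₁ × D₂) (i : ℕ) :
    transcript f₁ f₂ d.1 d.2 (i + 1) = message f₁ f₂ i d :: transcript f₁ f₂ d.1 d.2 i := rfl

/-- The round with index `i` is sent by a node that is allowed to transmit. -/
def IsActive (a₁ a₂ : Prop) (i : ℕ) : Prop := if i % 2 = 0 then a₁ else a₂

/-- Some active round with index less than `i` carries a message in its bad set. -/
def Fails (f₁ : List T → D₁ → T) (f₂ : List T → D₂ → T) (a₁ a₂ : Prop) (bad : ℕ → Finset T)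
    (i : ℕ) (d : D₁ × D₂) : Prop :=
  ∃ j < i, IsActive a₁ a₂ j ∧ message f₁ f₂ j d ∈ bad j

open scoped Classical in
/-- The message with index `i`, erased if the round is inactive or if a failure has occurred. -/
def erasedMessage (f₁ : List T → D₁ → T) (f₂ : List T → D₂ → T) (a₁ a₂ : Prop)
    (bad : ℕ → Finset T) (i : ℕ) (d : D₁ × D₂) : Option T :=
  if IsActive a₁ a₂ i ∧ ¬ Fails f₁ f₂ a₁ a₂ bad (i + 1) d then some (message f₁ f₂ i d) else none

variable {f₁ : List T → D₁ → T} {f₂ : List T → D₂ → T} {a₁ a₂ : Prop} {bad : ℕ → Finset T}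

lemma Fails.mono {i j : ℕ} (h : i ≤ j) {d : D₁ × D₂} (hf : Fails f₁ f₂ a₁ a₂ bad i d) :
    Fails f₁ f₂ a₁ a₂ bad j d := by
  obtain ⟨k, hk, hk'⟩ := hf
  exact ⟨k, hk.trans_le h, hk'⟩

lemma fails_of_erasedMessage_eq {i : ℕ} {d d' : D₁ × D₂}
    (h : ∀ j < i, erasedMessage f₁ f₂ a₁ a₂ bad j d = erasedMessage f₁ f₂ a₁ a₂ bad j d')
    (hf : Fails f₁ f₂ a₁ a₂ bad i d) : Fails f₁ f₂ a₁ a₂ bad i d' := by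
  obtain ⟨j, hj, hact, hbad⟩ := hf
  by_contra hn
  have h1 : erasedMessage f₁ f₂ a₁ a₂ bad j d = none := by
    rw [erasedMessage, if_neg]
    exact fun hh => hh.2 ⟨j, j.lt_succ_self, hact, hbad⟩
  have h2 : erasedMessage f₁ f₂ a₁ a₂ bad j d' = some (message f₁ f₂ j d') := by
    rw [erasedMessage, if_pos]
    exact ⟨hact, fun hh => hn (hh.mono hj)⟩
  rw [h j hj, h2] at h1
  exact Option.some_ne_none _ h1

lemma fails_iff_of_erasedMessage_eq {i : ℕ} {d d' : D₁ × D₂}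
    (h : ∀ j < i, erasedMessage f₁ f₂ a₁ a₂ bad j d = erasedMessage f₁ f₂ a₁ a₂ bad j d') :
    Fails f₁ f₂ a₁ a₂ bad i d ↔ Fails f₁ f₂ a₁ a₂ bad i d' :=
  ⟨fails_of_erasedMessage_eq h, fails_of_erasedMessage_eq fun j hj => (h j hj).symm⟩

lemma transcript_eq_of_erasedMessage_eq (h₁ : ¬ a₁ → ∀ l d d', f₁ l d = f₁ l d')
    (h₂ : ¬ a₂ → ∀ l d d', f₂ l d = f₂ l d') {i : ℕ} {d d' : D₁ × D₂}
    (h : ∀ j < i, erasedMessage f₁ f₂ a₁ a₂ bad j d = erasedMessage f₁ f₂ a₁ a₂ bad j d')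
    (hf : ¬ Fails f₁ f₂ a₁ a₂ bad i d) :
    transcript f₁ f₂ d.1 d.2 i = transcript f₁ f₂ d'.1 d'.2 i := by
  induction i with
  | zero => rfl
  | succ i ih =>
    have ih' := ih (fun j hj => h j (hj.trans i.lt_succ_self)) fun hh => hf (hh.mono i.le_succ)
    rw [transcript_succ, transcript_succ, ih']
    congr 1
    by_cases hact : IsActive a₁ a₂ i
    · have hi := h i i.lt_succ_self
      rw [erasedMessage, erasedMessage, if_pos ⟨hact, hf⟩,
        if_pos ⟨hact, fun hh => hf ((fails_iff_of_erasedMessage_eq h).2 hh)⟩] at hi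
      exact Option.some_injective _ hi
    · rw [message, message, ih']
      rw [IsActive] at hact
      split_ifs at hact ⊢ with hpar
      · exact h₁ hact _ _ _
      · exact h₂ hact _ _ _

lemma erasedMessage_eq_of_forall_lt (h₁ : ¬ a₁ → ∀ l d d', f₁ l d = f₁ l d')
    (h₂ : ¬ a₂ → ∀ l d d', f₂ l d = f₂ l d') {i : ℕ} {d d' : D₁ × D₂}
    (h : ∀ j < i, erasedMessage f₁ f₂ a₁ a₂ bad j d = erasedMessage f₁ f₂ a₁ a₂ bad j d')
    (hd₁ : i % 2 = 0 → d.1 = d'.1) (hd₂ : i % 2 = 1 → d.2 = d'.2) :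
    erasedMessage f₁ f₂ a₁ a₂ bad i d = erasedMessage f₁ f₂ a₁ a₂ bad i d' := by
  by_cases hf : Fails f₁ f₂ a₁ a₂ bad i d
  · have hf' := (fails_iff_of_erasedMessage_eq h).1 hf
    rw [erasedMessage, erasedMessage, if_neg fun hh => hh.2 (hf.mono i.le_succ),
      if_neg fun hh => hh.2 (hf'.mono i.le_succ)]
  · have hf' := fun hh => hf ((fails_iff_of_erasedMessage_eq h).2 hh)
    have ht := transcript_eq_of_erasedMessage_eq h₁ h₂ h hf
    have hm : message f₁ f₂ i d = message f₁ f₂ i d' := by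
      rw [message, message, ht]
      split_ifs with hpar
      · rw [hd₁ hpar]
      · rw [hd₂ (by lia)]
    have hiff : Fails f₁ f₂ a₁ a₂ bad (i + 1) d ↔ Fails f₁ f₂ a₁ a₂ bad (i + 1) d' := by
      constructor
      · rintro ⟨j, hj, hact, hbad⟩
        rcases Nat.lt_succ_iff_lt_or_eq.1 hj with hj | rfl
        · exact absurd ⟨j, hj, hact, hbad⟩ hf
        · exact ⟨j, hj, hact, hm ▸ hbad⟩
      · rintro ⟨j, hj, hact, hbad⟩
        rcases Nat.lt_succ_iff_lt_or_eq.1 hj with hj | rfl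
        · exact absurd ⟨j, hj, hact, hbad⟩ hf'
        · exact ⟨j, hj, hact, hm ▸ hbad⟩
    rw [erasedMessage, erasedMessage, hm]
    by_cases hact : IsActive a₁ a₂ i ∧ ¬ Fails f₁ f₂ a₁ a₂ bad (i + 1) d
    · rw [if_pos hact, if_pos (by rwa [← hiff])]
    · rw [if_neg hact, if_neg (by rwa [← hiff])]

end Transcript

section FunctionalCode

/-- Regroup sources and private randomness by node. -/
def byNode {A B C D : Type*} (w : (A × B) × (C × D)) : (A × C) × (B × D) :=
  ((w.1.1, w.2.1), (w.1.2, w.2.2))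

lemma exists_extension {ι A B : Type*} [Nonempty B] (s : Set ι) (g : ι → A) (h : ι → B)
    (hdet : ∀ a ∈ s, ∀ b ∈ s, g a = g b → h a = h b) : ∃ f : A → B, ∀ a ∈ s, f (g a) = h a := by
  classical
  refine ⟨fun x => if hx : ∃ a ∈ s, g a = x then h hx.choose else Classical.arbitrary B,
    fun a ha => ?_⟩
  have hx : ∃ b ∈ s, g b = g a := ⟨a, ha, rfl⟩
  simp only [dif_pos hx]
  exact hdet _ hx.choose_spec.1 _ ha hx.choose_spec.2

lemma exists_encoder {ι T D L : Type*} [Nonempty T] (s : Set ι) (l : ι → L) (d : ι → D)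
    (c : ι → T) (hdet : ∀ a ∈ s, ∀ b ∈ s, l a = l b → d a = d b → c a = c b) (P : Prop)
    (hP : P → ∀ a ∈ s, ∀ b ∈ s, l a = l b → c a = c b) :
    ∃ f : L → D → T, (∀ a ∈ s, f (l a) (d a) = c a) ∧ (P → ∀ l d d', f l d = f l d') := by
  by_cases h : P
  · obtain ⟨f, hf⟩ := exists_extension s l c (hP h)
    exact ⟨fun l _ => f l, hf, fun _ _ _ _ => rfl⟩
  · obtain ⟨f, hf⟩ := exists_extension s (fun a => (l a, d a)) c fun a ha b hb hab =>
      hdet a ha b hb (Prod.ext_iff.1 hab).1 (Prod.ext_iff.1 hab).2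
    exact ⟨fun l d => f (l, d), hf, fun hh => absurd hh h⟩

/-- The first `i` values of a sequence, latest first. -/
def listOf {T : Type*} (c : ℕ → T) (i : ℕ) : List T := ((List.range i).map c).reverse

lemma listOf_succ {T : Type*} (c : ℕ → T) (i : ℕ) : listOf c (i + 1) = c i :: listOf c i := by
  simp [listOf, List.range_succ]

lemma listOf_eq {T : Type*} {c c' : ℕ → T} {i j : ℕ} (h : listOf c i = listOf c' j) :
    i = j ∧ ∀ k < i, c k = c' k := by
  have hij : i = j := by simpa [listOf] using congrArg List.length h
  subst hij
  refine ⟨rfl, fun k hk => ?_⟩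
  have := List.reverse_injective h
  exact (List.map_inj_left.1 this) k (List.mem_range.2 hk)

lemma sum_filter_fin_eq_sum_range (r b : ℕ) (F : ℕ → ℝ) :
    ∑ i ∈ Finset.univ.filter (fun i : Fin r => (i : ℕ) % 2 = b), F i =
      ∑ i ∈ Finset.range r with i % 2 = b, F i := by
  rw [Finset.sum_filter, Finset.sum_filter,
    ← Fin.sum_univ_eq_sum_range (fun i => if i % 2 = b then F i else 0)]

/-- A code in functional form: explicit private randomness, encoders and decoders for which the
protocol satisfies the rate constraints and approximates the target when the sources are i.i.d. -/
theorem Admissible.exists_functional {S₁ S₂ Y₁ Y₂ : Type} [Fintype S₁] [DecidableEq S₁]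
    [Fintype S₂] [DecidableEq S₂] [Fintype Y₁] [DecidableEq Y₁] [Fintype Y₂] [DecidableEq Y₂]
    {q : S₁ × S₂ × Y₁ × Y₂ → ℝ} {r : ℕ} {R12 R21 : ℝ} (h : Admissible q r R12 R21)
    {ε : ℝ} (hε : 0 < ε) :
    ∃ n₀ : ℕ, ∀ n : ℕ, n₀ ≤ n → ∃ (N₁ N₂ T : Type) (_ : Fintype N₁) (_ : DecidableEq N₁)
      (_ : Fintype N₂) (_ : DecidableEq N₂) (_ : Fintype T) (_ : DecidableEq T)
      (ν₁ : N₁ → ℝ) (ν₂ : N₂ → ℝ)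
      (f₁ : List T → (Fin n → S₁) × N₁ → T) (f₂ : List T → (Fin n → S₂) × N₂ → T)
      (g₁ : List T → (Fin n → S₁) × N₁ → Fin n → Y₁)
      (g₂ : List T → (Fin n → S₂) × N₂ → Fin n → Y₂)
      (P : (Fin n → S₁) × (Fin n → S₂) → ℝ)
      (Q : ((Fin n → S₁) × (Fin n → S₂)) × (N₁ × N₂) → ℝ),
      IsPMF ν₁ ∧ IsPMF ν₂ ∧ IsPMF P ∧ (P = fun x => ∏ k, srcMarg q (x.1 k, x.2 k)) ∧
      (Q = fun w => P w.1 * (ν₁ w.2.1 * ν₂ w.2.2)) ∧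
      (∑ i ∈ Finset.range r with i % 2 = 0, H Q (fun w => message f₁ f₂ i (byNode w)) ≤ n * R12) ∧
      (∑ i ∈ Finset.range r with i % 2 = 1, H Q (fun w => message f₁ f₂ i (byNode w)) ≤ n * R21) ∧
      (R12 ≤ 0 → ∀ l d d', f₁ l d = f₁ l d') ∧ (R21 ≤ 0 → ∀ l d d', f₂ l d = f₂ l d') ∧
      l1dist (distr Q fun w => (w.1.1, w.1.2,
          g₁ (transcript f₁ f₂ (byNode w).1 (byNode w).2 r) (byNode w).1,
          g₂ (transcript f₁ f₂ (byNode w).1 (byNode w).2 r) (byNode w).2))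
        (fun a => ∏ k, q (a.1 k, a.2.1 k, a.2.2.1 k, a.2.2.2 k)) ≤ ε := by
  obtain ⟨n₀, hn₀⟩ := h ε hε
  refine ⟨n₀, fun n hn => ?_⟩
  obtain ⟨Ω, N₁, N₂, C', _, _, _, _, _, _, _, _, μ, X₁, X₂, M₁, M₂, C, Z₁, Z₂, hμ, hX, hind,
    hC₁, hC₂, hR₁, hR₂, hZ₁, hZ₂, hdist⟩ := hn₀ n hn
  have hΩ : Nonempty Ω := by
    by_contra hne
    rw [not_nonempty_iff] at hne
    simpa using hμ.2
  obtain ⟨ω₀⟩ := hΩ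
  have hN₁ : Nonempty (Fin n → Y₁) := ⟨Z₁ ω₀⟩
  have hN₂ : Nonempty (Fin n → Y₂) := ⟨Z₂ ω₀⟩
  let T := Option (Σ i : Fin r, C' i)
  let c : ℕ → Ω → T := fun i ω => if hi : i < r then some ⟨⟨i, hi⟩, C ⟨i, hi⟩ ω⟩ else none
  have hc : ∀ i : Fin r, ∀ ω, c i ω = some ⟨i, C i ω⟩ := fun i ω => by simp [c]
  have hc_iff : ∀ (i : Fin r) ω ω', c i ω = c i ω' ↔ C i ω = C i ω' := fun i ω ω' => by
    rw [hc, hc, Option.some_inj]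
    simp
  have hHc : ∀ i : Fin r, H μ (c i) = H μ (C i) := fun i => by
    have : c i = fun ω => (fun x : C' i => (some ⟨i, x⟩ : T)) (C i ω) := funext (hc i)
    rw [this]
    exact H_comp_injective μ (C i) (e := fun x : C' i => (some ⟨i, x⟩ : T)) fun x y hxy => by
      simpa using hxy
  let L : ℕ × Ω → List T := fun a => listOf (fun j => c j a.2) a.1
  let D₁ : Ω → (Fin n → S₁) × N₁ := fun ω => (X₁ ω, M₁ ω)
  let D₂ : Ω → (Fin n → S₂) × N₂ := fun ω => (X₂ ω, M₂ ω)
  let s : ℕ → Set (ℕ × Ω) := fun b => {a | a.1 < r ∧ a.1 % 2 = b ∧ μ a.2 ≠ 0}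
  have hL : ∀ a b : ℕ × Ω, a.1 < r → L a = L b → a.1 = b.1 ∧ ∀ j : Fin r, j < a.1 →
      C j a.2 = C j b.2 := by
    intro a b ha hab
    obtain ⟨h1, h2⟩ := listOf_eq hab
    exact ⟨h1, fun j hj => (hc_iff j _ _).1 (h2 j hj)⟩
  have hzero : ∀ (b : ℕ) (R : ℝ), R ≤ 0 →
      (∑ i ∈ Finset.univ.filter (fun i : Fin r => (i : ℕ) % 2 = b), H μ (C i)) ≤ n * R →
      ∀ a ∈ s b, ∀ a' ∈ s b, L a = L a' → c a.1 a.2 = c a'.1 a'.2 := by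
    rintro b R hR hsum ⟨i, ω⟩ ⟨hi, hb, hω⟩ ⟨i', ω'⟩ ⟨-, -, hω'⟩ hLL
    obtain rfl : i = i' := (hL _ _ hi hLL).1
    have hmem : (⟨i, hi⟩ : Fin r) ∈ Finset.univ.filter (fun i : Fin r => (i : ℕ) % 2 = b) :=
      Finset.mem_filter.2 ⟨Finset.mem_univ _, hb⟩
    refine (hc_iff ⟨i, hi⟩ _ _).2 (eq_of_H_eq_zero hμ ?_ hω hω')
    refine (Finset.sum_eq_zero_iff_of_nonneg fun j _ => H_nonneg hμ (C j)).1
      (le_antisymm ?_ (Finset.sum_nonneg fun j _ => H_nonneg hμ (C j))) _ hmem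
    exact hsum.trans (mul_nonpos_of_nonneg_of_nonpos (Nat.cast_nonneg n) hR)
  obtain ⟨f₁, hf₁, hf₁'⟩ := exists_encoder (s 0) L (fun a => D₁ a.2) (fun a => c a.1 a.2)
    (by
      rintro ⟨i, ω⟩ ⟨hi, hb, hω⟩ ⟨i', ω'⟩ ⟨-, -, hω'⟩ hLL hD
      obtain ⟨hii, hpre⟩ := hL _ _ hi hLL
      obtain rfl : i = i' := hii
      have hD' := Prod.ext_iff.1 hD
      refine (hc_iff ⟨i, hi⟩ _ _).2
        ((condEnt_eq_zero_iff hμ _ _).1 (hC₁ ⟨i, hi⟩ hb) ω ω' hω hω' ?_)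
      exact Prod.ext (funext fun j => hpre ⟨j, j.2.trans hi⟩ j.2) (Prod.ext hD'.1 hD'.2))
    (R12 ≤ 0) fun hR => hzero 0 R12 hR hR₁
  obtain ⟨f₂, hf₂, hf₂'⟩ := exists_encoder (s 1) L (fun a => D₂ a.2) (fun a => c a.1 a.2)
    (by
      rintro ⟨i, ω⟩ ⟨hi, hb, hω⟩ ⟨i', ω'⟩ ⟨-, -, hω'⟩ hLL hD
      obtain ⟨hii, hpre⟩ := hL _ _ hi hLL
      obtain rfl : i = i' := hii
      have hD' := Prod.ext_iff.1 hD
      refine (hc_iff ⟨i, hi⟩ _ _).2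
        ((condEnt_eq_zero_iff hμ _ _).1 (hC₂ ⟨i, hi⟩ hb) ω ω' hω hω' ?_)
      exact Prod.ext (funext fun j => hpre ⟨j, j.2.trans hi⟩ j.2) (Prod.ext hD'.1 hD'.2))
    (R21 ≤ 0) fun hR => hzero 1 R21 hR hR₂
  have hLr : ∀ ω ω', L (r, ω) = L (r, ω') → (fun i : Fin r => C i ω) = fun i => C i ω' :=
    fun ω ω' hh => funext fun i => (hc_iff i _ _).1 ((listOf_eq hh).2 i i.2)
  obtain ⟨g₁, hg₁, -⟩ := exists_encoder {ω | μ ω ≠ 0} (fun ω => L (r, ω)) D₁ Z₁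
    (fun ω hω ω' hω' hLL hD => (condEnt_eq_zero_iff hμ _ _).1 hZ₁ ω ω' hω hω' (by
      have hD' := Prod.ext_iff.1 hD
      exact Prod.ext hD'.1 (Prod.ext hD'.2 (hLr _ _ hLL)))) False False.elim
  obtain ⟨g₂, hg₂, -⟩ := exists_encoder {ω | μ ω ≠ 0} (fun ω => L (r, ω)) D₂ Z₂
    (fun ω hω ω' hω' hLL hD => (condEnt_eq_zero_iff hμ _ _).1 hZ₂ ω ω' hω hω' (by
      have hD' := Prod.ext_iff.1 hD
      exact Prod.ext hD'.1 (Prod.ext hD'.2 (hLr _ _ hLL)))) False False.elim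
  have hmsg : ∀ ω, μ ω ≠ 0 → ∀ i < r,
      transcript f₁ f₂ (D₁ ω) (D₂ ω) i = L (i, ω) → message f₁ f₂ i (D₁ ω, D₂ ω) = c i ω := by
    intro ω hω i hi htr
    rw [message, htr]
    split_ifs with hpar
    · exact hf₁ (i, ω) ⟨hi, hpar, hω⟩
    · exact hf₂ (i, ω) ⟨hi, by simpa using hpar, hω⟩
  have htr : ∀ ω, μ ω ≠ 0 → ∀ i ≤ r, transcript f₁ f₂ (D₁ ω) (D₂ ω) i = L (i, ω) := by
    intro ω hω i
    induction i with
    | zero => exact fun _ => rfl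
    | succ i ih =>
      intro hi
      have ih' := ih (Nat.le_of_succ_le hi)
      have := transcript_succ f₁ f₂ (D₁ ω, D₂ ω) i
      rw [this, hmsg ω hω i hi ih', ih']
      exact (listOf_succ (fun j => c j ω) i).symm
  set P := distr μ fun ω => (X₁ ω, X₂ ω) with hP
  set Φ : Ω → ((Fin n → S₁) × (Fin n → S₂)) × (N₁ × N₂) := fun ω => ((X₁ ω, X₂ ω), (M₁ ω, M₂ ω))
  have hQ : distr μ Φ = fun w => P w.1 * (distr μ M₁ w.2.1 * distr μ M₂ w.2.2) := by
    funext w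
    have := distr_comp_injective μ Φ
      (e := fun w => (w.2.1, w.2.2, w.1.1, w.1.2))
      (by rintro ⟨⟨a, b⟩, c, d⟩ ⟨⟨a', b'⟩, c', d'⟩ hh; simp only [Prod.mk.injEq] at hh ⊢; tauto) w
    rw [← this, mul_comm]
    exact congrFun hind _
  have hHmsg : ∀ i < r, H (distr μ Φ) (fun w => message f₁ f₂ i (byNode w)) = H μ (c i) := by
    intro i hi
    rw [H_distr]
    exact H_congr fun ω hω => hmsg ω hω i hi (htr ω hω i hi.le)
  have hsums : ∀ b, ∑ i ∈ Finset.range r with i % 2 = b,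
      H (distr μ Φ) (fun w => message f₁ f₂ i (byNode w)) =
      ∑ i ∈ Finset.univ.filter (fun i : Fin r => (i : ℕ) % 2 = b), H μ (C i) := by
    intro b
    exact (sum_filter_fin_eq_sum_range r b _).symm.trans
      (Finset.sum_congr rfl fun i _ => by rw [hHmsg i i.2, hHc])
  refine ⟨N₁, N₂, T, inferInstance, inferInstance, inferInstance, inferInstance, inferInstance,
    inferInstance, distr μ M₁, distr μ M₂, f₁, f₂, g₁, g₂, P, distr μ Φ, hμ.distr M₁, hμ.distr M₂,
    hμ.distr _, hX, hQ, (hsums 0).trans_le hR₁, (hsums 1).trans_le hR₂, hf₁', hf₂', ?_⟩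
  rw [distr_distr]
  refine le_of_eq_of_le ?_ hdist
  congr 1
  refine distr_congr fun ω hω => ?_
  simp only [Φ, byNode, Prod.mk.injEq, true_and]
  exact ⟨by rw [← hg₁ ω hω, ← htr ω hω r le_rfl], by rw [← hg₂ ω hω, ← htr ω hω r le_rfl]⟩

end FunctionalCode

section Robust

variable {T : Type*} [Fintype T] [DecidableEq T]

/-- Erasing the messages in suitable bad sets bounds their entropies in terms of the entropies of
the original messages under a nearby law. -/
lemma exists_bad_sets {D₁ D₂ W : Type*} [Fintype W] {Q Q' : W → ℝ} (hQ : IsPMF Q) (hQ' : IsPMF Q')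
    {δ : ℝ} (hd : l1dist Q' Q ≤ δ) (loc : W → D₁ × D₂)
    (f₁ : List T → D₁ → T) (f₂ : List T → D₂ → T) (a₁ a₂ : Prop) {k : ℕ} (hk : 0 < k) :
    ∃ bad : ℕ → Finset T,
      (∀ i, ∑ a ∈ bad i, distr Q' (fun w => message f₁ f₂ i (loc w)) a ≤
        2 / k + (2 + 2 * k) * δ) ∧
      (∀ i, IsActive a₁ a₂ i → H Q' (fun w => erasedMessage f₁ f₂ a₁ a₂ bad i (loc w)) ≤
        1 + 2 * Real.logb 2 k + (1 - 1 / (2 * k)) * H Q (fun w => message f₁ f₂ i (loc w))) ∧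
      (∀ i, ¬ IsActive a₁ a₂ i → H Q' (fun w => erasedMessage f₁ f₂ a₁ a₂ bad i (loc w)) = 0) := by
  choose bad hbad hent using fun i => exists_erasure_event
    (hQ.distr fun w => message f₁ f₂ i (loc w))
    ((l1dist_distr_le Q' Q fun w => message f₁ f₂ i (loc w)).trans hd) hk
  refine ⟨bad, hbad, fun i hi => hent i _ (hQ'.distr _) (fun a => ?_) (fun a ha => ?_),
    fun i hi => ?_⟩
  · refine Finset.sum_le_sum fun w _ => ?_
    by_cases h : erasedMessage f₁ f₂ a₁ a₂ bad i (loc w) = some a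
    · have hm : message f₁ f₂ i (loc w) = a := by
        rw [erasedMessage] at h
        split_ifs at h
        exact Option.some_injective _ h
      rw [if_pos h, if_pos hm]
    · rw [if_neg h]
      split_ifs
      exacts [hQ'.1 w, le_rfl]
  · refine Finset.sum_eq_zero fun w _ => if_neg fun h => ?_
    simp only [erasedMessage] at h
    split_ifs at h with hh
    obtain rfl := Option.some_injective _ h
    exact hh.2 ⟨i, i.lt_succ_self, hi, ha⟩
  · have : (fun w => erasedMessage f₁ f₂ a₁ a₂ bad i (loc w)) = fun _ => none :=
      funext fun w => if_neg fun h => hi h.1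
    rw [this, H_const hQ']

lemma sum_fails_le {D₁ D₂ W : Type*} [Fintype W] {Q' : W → ℝ} (hQ' : ∀ w, 0 ≤ Q' w)
    (loc : W → D₁ × D₂) (f₁ : List T → D₁ → T) (f₂ : List T → D₂ → T) (a₁ a₂ : Prop)
    (bad : ℕ → Finset T) (r : ℕ) {c : ℝ}
    (hbad : ∀ i, ∑ a ∈ bad i, distr Q' (fun w => message f₁ f₂ i (loc w)) a ≤ c)
    [DecidablePred fun w => Fails f₁ f₂ a₁ a₂ bad r (loc w)] :
    ∑ w with Fails f₁ f₂ a₁ a₂ bad r (loc w), Q' w ≤ r * c := by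
  have hi : ∀ i, ∑ a ∈ bad i, distr Q' (fun w => message f₁ f₂ i (loc w)) a =
      ∑ w with message f₁ f₂ i (loc w) ∈ bad i, Q' w := fun i => by
    rw [← sum_filter_distr Q' (fun w => message f₁ f₂ i (loc w)) (fun a => a ∈ bad i)]
    simp
  calc ∑ w with Fails f₁ f₂ a₁ a₂ bad r (loc w), Q' w
      ≤ ∑ w, ∑ i ∈ Finset.range r, if message f₁ f₂ i (loc w) ∈ bad i then Q' w else 0 := by
        rw [Finset.sum_filter]
        refine Finset.sum_le_sum fun w _ => ?_
        have h0 : ∀ i ∈ Finset.range r, 0 ≤ if message f₁ f₂ i (loc w) ∈ bad i then Q' w else 0 :=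
          fun i _ => by split_ifs; exacts [hQ' w, le_rfl]
        split_ifs with hf
        · obtain ⟨j, hj, -, hb⟩ := hf
          refine le_of_eq_of_le ?_ (Finset.single_le_sum h0 (Finset.mem_range.2 hj))
          rw [if_pos hb]
        · exact Finset.sum_nonneg h0
    _ = ∑ i ∈ Finset.range r, ∑ w with message f₁ f₂ i (loc w) ∈ bad i, Q' w := by
        rw [Finset.sum_comm]
        exact Finset.sum_congr rfl fun i _ => (Finset.sum_filter _ _).symm
    _ ≤ ∑ i ∈ Finset.range r, c := Finset.sum_le_sum fun i _ => (hi i).symm.trans_le (hbad i)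
    _ = r * c := by simp

/-- A code that tolerates a small perturbation of the source law without any loss in rate. -/
theorem Admissible.exists_robust {S₁ S₂ Y₁ Y₂ : Type} [Fintype S₁] [DecidableEq S₁]
    [Fintype S₂] [DecidableEq S₂] [Fintype Y₁] [DecidableEq Y₁] [Fintype Y₂] [DecidableEq Y₂]
    {q : S₁ × S₂ × Y₁ × Y₂ → ℝ} {r : ℕ} {R12 R21 : ℝ} (h : Admissible q r R12 R21)
    {ε : ℝ} (hε : 0 < ε) :
    ∃ δ : ℝ, 0 < δ ∧ ∃ n₀ : ℕ, ∀ n : ℕ, n₀ ≤ n →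
      ∀ P' : (Fin n → S₁) × (Fin n → S₂) → ℝ, IsPMF P' →
      l1dist P' (fun x => ∏ k, srcMarg q (x.1 k, x.2 k)) ≤ δ →
      ∃ (N₁ N₂ T : Type) (_ : Fintype N₁) (_ : DecidableEq N₁)
        (_ : Fintype N₂) (_ : DecidableEq N₂) (_ : Fintype T) (_ : DecidableEq T)
        (ν₁ : N₁ → ℝ) (ν₂ : N₂ → ℝ)
        (B : ℕ → ((Fin n → S₁) × N₁) × ((Fin n → S₂) × N₂) → T)
        (y₁ : ((Fin n → S₁) × N₁) × ((Fin n → S₂) × N₂) → Fin n → Y₁)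
        (y₂ : ((Fin n → S₁) × N₁) × ((Fin n → S₂) × N₂) → Fin n → Y₂)
        (Q' : ((Fin n → S₁) × (Fin n → S₂)) × (N₁ × N₂) → ℝ),
        IsPMF ν₁ ∧ IsPMF ν₂ ∧ (Q' = fun w => P' w.1 * (ν₁ w.2.1 * ν₂ w.2.2)) ∧
        (∀ i d d', (∀ j < i, B j d = B j d') → (i % 2 = 0 → d.1 = d'.1) →
          (i % 2 = 1 → d.2 = d'.2) → B i d = B i d') ∧
        (∀ d d', (∀ j < r, B j d = B j d') → d.1 = d'.1 → y₁ d = y₁ d') ∧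
        (∀ d d', (∀ j < r, B j d = B j d') → d.2 = d'.2 → y₂ d = y₂ d') ∧
        (∑ i ∈ Finset.range r with i % 2 = 0, H Q' (fun w => B i (byNode w)) ≤ n * R12) ∧
        (∑ i ∈ Finset.range r with i % 2 = 1, H Q' (fun w => B i (byNode w)) ≤ n * R21) ∧
        l1dist (distr Q' fun w => (w.1.1, w.1.2, y₁ (byNode w), y₂ (byNode w)))
          (fun a => ∏ k, q (a.1 k, a.2.1 k, a.2.2.1 k, a.2.2.2 k)) ≤ ε := by
  classical
  obtain ⟨n₂, hn₂⟩ := h.exists_functional (ε := ε / 4) (by positivity)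
  obtain ⟨k, hk⟩ := exists_nat_gt (16 * r / ε)
  have hk0 : (0 : ℝ) < k := lt_of_le_of_lt (by positivity) hk
  have hk0' : 0 < k := by exact_mod_cast hk0
  have hk1 : (1 : ℝ) ≤ k := by exact_mod_cast hk0'
  set K : ℝ := 1 + 2 * Real.logb 2 k with hK
  have hK0 : 0 ≤ K := by
    have := Real.logb_nonneg (b := 2) (by norm_num) hk1
    positivity
  have hN : ∀ R : ℝ, ∃ N : ℕ, ∀ n : ℕ, N ≤ n → 0 < R → r * K ≤ n * R / (2 * k) := by
    intro R
    obtain ⟨N, hN⟩ := exists_nat_ge (r * K * (2 * k) / R)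
    refine ⟨N, fun n hn hR => ?_⟩
    rw [le_div_iff₀ (by positivity), ← div_le_iff₀ hR]
    exact hN.trans (by exact_mod_cast hn)
  obtain ⟨N12, hN12⟩ := hN R12
  obtain ⟨N21, hN21⟩ := hN R21
  set δ : ℝ := ε / 4 / (1 + 2 * r * (2 + 2 * k)) with hδ
  have hδ0 : 0 < δ := by positivity
  have hδε : δ * (1 + 2 * r * (2 + 2 * k)) = ε / 4 := by
    rw [hδ]; field_simp
  have hkε : 2 * (r * (2 / k)) ≤ ε / 4 := by
    rw [div_lt_iff₀ hε] at hk
    rw [← mul_div_assoc, ← mul_div_assoc, div_le_iff₀ hk0]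
    linarith
  refine ⟨δ, hδ0, max n₂ (max N12 N21), fun n hn P' hP' hPd => ?_⟩
  have hn12 := hN12 n ((le_max_left _ _).trans ((le_max_right _ _).trans hn))
  have hn21 := hN21 n ((le_max_right _ _).trans ((le_max_right _ _).trans hn))
  obtain ⟨N₁, N₂, T, _, _, _, _, _, _, ν₁, ν₂, f₁, f₂, g₁, g₂, P, Q, hν₁, hν₂, hP, hPq, hQ,
    hR₁, hR₂, hf₁, hf₂, hdist⟩ := hn₂ n ((le_max_left _ _).trans hn)
  set Q' : ((Fin n → S₁) × (Fin n → S₂)) × (N₁ × N₂) → ℝ :=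
    fun w => P' w.1 * (ν₁ w.2.1 * ν₂ w.2.2) with hQ'
  have hν := hν₁.prod hν₂
  have hQpmf : IsPMF Q := hQ ▸ hP.prod hν
  have hQ'pmf : IsPMF Q' := hP'.prod hν
  have hQd : l1dist Q' Q ≤ δ := by
    rw [hQ', hQ, l1dist_prod_right P' P hν, hPq]
    exact hPd
  obtain ⟨bad, hbad, hact, hinact⟩ := exists_bad_sets hQpmf hQ'pmf hQd byNode f₁ f₂
    (0 < R12) (0 < R21) hk0'
  have h₁ : ¬ 0 < R12 → ∀ l d d', f₁ l d = f₁ l d' := fun hh => hf₁ (not_lt.1 hh)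
  have h₂ : ¬ 0 < R21 → ∀ l d d', f₂ l d = f₂ l d' := fun hh => hf₂ (not_lt.1 hh)
  have hrate : ∀ (b : ℕ) (R : ℝ), (0 < R → r * K ≤ n * R / (2 * k)) →
      (∀ i, i % 2 = b → (IsActive (0 < R12) (0 < R21) i ↔ 0 < R)) →
      (∑ i ∈ Finset.range r with i % 2 = b, H Q (fun w => message f₁ f₂ i (byNode w)) ≤ n * R) →
      ∑ i ∈ Finset.range r with i % 2 = b,
        H Q' (fun w => erasedMessage f₁ f₂ (0 < R12) (0 < R21) bad i (byNode w)) ≤ n * R := by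
    intro b R hR hiff hsum
    by_cases hR0 : 0 < R
    · calc _ ≤ ∑ i ∈ Finset.range r with i % 2 = b,
            (K + (1 - 1 / (2 * k)) * H Q (fun w => message f₁ f₂ i (byNode w))) :=
          Finset.sum_le_sum fun i hi =>
            hact i ((hiff i (Finset.mem_filter.1 hi).2).2 hR0)
        _ ≤ r * K + (1 - 1 / (2 * k)) * (n * R) := by
          rw [Finset.sum_add_distrib, ← Finset.mul_sum, Finset.sum_const, nsmul_eq_mul]
          have hcard : (((Finset.range r).filter fun i => i % 2 = b).card : ℝ) ≤ r := by
            exact_mod_cast (Finset.card_filter_le _ _).trans (Finset.card_range r).le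
          have hk2 : (0 : ℝ) ≤ 1 - 1 / (2 * k) := by
            rw [sub_nonneg, div_le_one (by positivity)]
            linarith
          gcongr
        _ ≤ n * R := by
          have h1 := hR hR0
          have h2 : 1 / (2 * k) * (n * R) = n * R / (2 * k) := by ring
          linarith
    · rw [Finset.sum_eq_zero fun i hi =>
        hinact i fun ha => hR0 ((hiff i (Finset.mem_filter.1 hi).2).1 ha)]
      exact (Finset.sum_nonneg fun i _ => H_nonneg hQpmf _).trans hsum
  set fails := Fails f₁ f₂ (0 < R12) (0 < R21) bad r with hfails
  refine ⟨N₁, N₂, Option T, inferInstance, inferInstance, inferInstance, inferInstance,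
    inferInstance, inferInstance, ν₁, ν₂, erasedMessage f₁ f₂ (0 < R12) (0 < R21) bad,
    fun d => if fails d then g₁ [] d.1 else g₁ (transcript f₁ f₂ d.1 d.2 r) d.1,
    fun d => if fails d then g₂ [] d.2 else g₂ (transcript f₁ f₂ d.1 d.2 r) d.2,
    Q', hν₁, hν₂, rfl,
    fun i d d' hB hd₁ hd₂ => erasedMessage_eq_of_forall_lt h₁ h₂ hB hd₁ hd₂,
    fun d d' hB hd => ?_, fun d d' hB hd => ?_,
    hrate 0 R12 hn12 (fun i hi => by rw [IsActive, if_pos hi]) hR₁,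
    hrate 1 R21 hn21 (fun i hi => by rw [IsActive, if_neg (by lia)]) hR₂, ?_⟩
  · have hiff : fails d ↔ fails d' := fails_iff_of_erasedMessage_eq hB
    by_cases hf : fails d
    · simp only [if_pos hf, if_pos (hiff.1 hf), hd]
    · simp only [if_neg hf, if_neg (mt hiff.2 hf)]
      rw [transcript_eq_of_erasedMessage_eq h₁ h₂ hB hf, hd]
  · have hiff : fails d ↔ fails d' := fails_iff_of_erasedMessage_eq hB
    by_cases hf : fails d
    · simp only [if_pos hf, if_pos (hiff.1 hf), hd]
    · simp only [if_neg hf, if_neg (mt hiff.2 hf)]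
      rw [transcript_eq_of_erasedMessage_eq h₁ h₂ hB hf, hd]
  · have hoff := l1dist_distr_le_of_eq_off hQ'pmf.1
      (X := fun w => (w.1.1, w.1.2,
        if fails (byNode w) then g₁ [] (byNode w).1
          else g₁ (transcript f₁ f₂ (byNode w).1 (byNode w).2 r) (byNode w).1,
        if fails (byNode w) then g₂ [] (byNode w).2
          else g₂ (transcript f₁ f₂ (byNode w).1 (byNode w).2 r) (byNode w).2))
      (Y := fun w => (w.1.1, w.1.2,
        g₁ (transcript f₁ f₂ (byNode w).1 (byNode w).2 r) (byNode w).1,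
        g₂ (transcript f₁ f₂ (byNode w).1 (byNode w).2 r) (byNode w).2))
      (fun w => fails (byNode w)) (fun w hw => by simp only [if_neg hw])
    have hprob := sum_fails_le hQ'pmf.1 byNode f₁ f₂ (0 < R12) (0 < R21) bad r hbad
    refine (l1dist_triangle _ _ _).trans ((add_le_add hoff ((l1dist_triangle _ _ _).trans
      (add_le_add ((l1dist_distr_le Q' Q _).trans hQd) hdist))).trans ?_)
    have : 2 * (r * (2 / k + (2 + 2 * k) * δ)) + δ ≤ ε / 4 + ε / 4 := by
      rw [← hδε] at hkε ⊢
      linarith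
    linarith

end Robust

section Marginals

lemma eq_distr_of_inverse [Fintype α] [DecidableEq β] (p : β → ℝ) {e : α → β} {e' : β → α}
    (h : Function.LeftInverse e' e) (h' : Function.RightInverse e' e) :
    p = distr (fun a => p (e a)) e := by
  classical
  funext b
  have := distr_comp_injective (fun a => p (e a)) (fun a => a) h.injective (e' b)
  rw [h' b, distr_id, h' b] at this
  exact this.symm

lemma distr_prod [Fintype α] [DecidableEq β] {n : ℕ} (p : α → ℝ) (g : α → β) :
    distr (fun a : Fin n → α => ∏ k, p (a k)) (fun a k => g (a k)) =
      fun b => ∏ k, distr p g (b k) := by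
  funext b
  simp only [distr]
  rw [Finset.prod_univ_sum, Fintype.piFinset_univ]
  refine Finset.sum_congr rfl fun a _ => ?_
  split_ifs with h
  · exact Finset.prod_congr rfl fun k _ => (if_pos (congrFun h k)).symm
  · obtain ⟨k, hk⟩ := Function.ne_iff.1 h
    exact (Finset.prod_eq_zero (Finset.mem_univ k) (if_neg hk)).symm

/-- Marginalizing a product law of quadruples letterwise. -/
lemma distr_prod_quadruple {A₁ A₂ B₁ B₂ S₁ S₂ : Type*} [Fintype A₁] [Fintype A₂] [Fintype B₁]
    [Fintype B₂] [DecidableEq A₁] [DecidableEq A₂] [DecidableEq B₁] [DecidableEq B₂]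
    [Fintype S₁] [Fintype S₂] [DecidableEq S₁] [DecidableEq S₂] {n : ℕ}
    (q : S₁ × S₂ × B₁ × B₂ → ℝ) (g₁ : S₁ → A₁) (g₂ : S₂ → A₂) :
    distr (fun a : (Fin n → S₁) × (Fin n → S₂) × (Fin n → B₁) × (Fin n → B₂) =>
        ∏ k, q (a.1 k, a.2.1 k, a.2.2.1 k, a.2.2.2 k))
      (fun a => ((fun k => g₁ (a.1 k)), (fun k => g₂ (a.2.1 k)), a.2.2.1, a.2.2.2)) =
      fun b => ∏ k, distr q (fun a => (g₁ a.1, g₂ a.2.1, a.2.2.1, a.2.2.2))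
        (b.1 k, b.2.1 k, b.2.2.1 k, b.2.2.2 k) := by
  have hl := eq_distr_of_inverse
    (fun a : (Fin n → S₁) × (Fin n → S₂) × (Fin n → B₁) × (Fin n → B₂) =>
        ∏ k, q (a.1 k, a.2.1 k, a.2.2.1 k, a.2.2.2 k))
    (e := fun f : Fin n → S₁ × S₂ × B₁ × B₂ => (fun k => (f k).1, fun k => (f k).2.1,
      fun k => (f k).2.2.1, fun k => (f k).2.2.2))
    (e' := fun a k => (a.1 k, a.2.1 k, a.2.2.1 k, a.2.2.2 k)) (fun _ => rfl) (fun _ => rfl)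
  have hr := eq_distr_of_inverse
    (fun b : (Fin n → A₁) × (Fin n → A₂) × (Fin n → B₁) × (Fin n → B₂) =>
      ∏ k, distr q (fun a => (g₁ a.1, g₂ a.2.1, a.2.2.1, a.2.2.2))
        (b.1 k, b.2.1 k, b.2.2.1 k, b.2.2.2 k))
    (e := fun f : Fin n → A₁ × A₂ × B₁ × B₂ => (fun k => (f k).1, fun k => (f k).2.1,
      fun k => (f k).2.2.1, fun k => (f k).2.2.2))
    (e' := fun a k => (a.1 k, a.2.1 k, a.2.2.1 k, a.2.2.2 k)) (fun _ => rfl) (fun _ => rfl)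
  rw [hl, hr, distr_distr]
  have hp := distr_prod (n := n) q fun a => (g₁ a.1, g₂ a.2.1, a.2.2.1, a.2.2.2)
  rw [← hp, distr_distr]

lemma distr_fst_fst_quadruple {A₁ A₂ C₁ C₂ B₁ B₂ : Type*} [Fintype A₁] [Fintype A₂] [Fintype C₁]
    [Fintype C₂] [Fintype B₁] [Fintype B₂] [DecidableEq A₁] [DecidableEq A₂] [DecidableEq B₁]
    [DecidableEq B₂] (q : (A₁ × C₁) × (A₂ × C₂) × B₁ × B₂ → ℝ) (b : A₁ × A₂ × B₁ × B₂) :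
    distr q (fun a => (a.1.1, a.2.1.1, a.2.2.1, a.2.2.2)) b =
      ∑ z₁, ∑ z₂, q ((b.1, z₁), (b.2.1, z₂), b.2.2.1, b.2.2.2) := by
  obtain ⟨a₁, a₂, b₁, b₂⟩ := b
  simp only [distr, Fintype.sum_prod_type, Prod.mk.injEq, ite_and]
  rw [Finset.sum_comm]
  simp only [Finset.sum_ite_irrel, Finset.sum_const_zero, Finset.sum_ite_eq', Finset.mem_univ,
    if_true]

lemma sum_filter_range_shift {r₁ r₂ s : ℕ} (hs : s ≤ r₁) (hs2 : s % 2 = 0) (b : ℕ) (G : ℕ → ℝ) :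
    ∑ i ∈ Finset.range (r₁ + r₂) with i % 2 = b, (if s ≤ i ∧ i - s < r₂ then G (i - s) else 0) =
      ∑ j ∈ Finset.range r₂ with j % 2 = b, G j := by
  rw [← Finset.sum_filter, Finset.filter_filter]
  refine Finset.sum_nbij' (fun i => i - s) (fun j => j + s) ?_ ?_ ?_ ?_ fun _ _ => rfl
  all_goals
    intro i
    simp only [Finset.mem_filter, Finset.mem_range]
    lia

lemma sum_filter_range_add (r₁ r₂ b : ℕ) (G : ℕ → ℝ) :
    ∑ i ∈ Finset.range (r₁ + r₂) with i % 2 = b, (if i < r₁ then G i else 0) =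
      ∑ j ∈ Finset.range r₁ with j % 2 = b, G j := by
  rw [← Finset.sum_filter, Finset.filter_filter]
  refine Finset.sum_congr (Finset.ext fun i => ?_) fun _ _ => rfl
  simp only [Finset.mem_filter, Finset.mem_range]
  lia

end Marginals

set_option synthInstance.maxSize 1000 in
/-- Theorem 5 of the paper, concatenation of coordination codes. Let
`q6(x¹,x²,z¹,z²,y¹,y²)` be a joint pmf. If `(R12, R21)` is admissible with `r₁` rounds
for the coordination problem with sources `(X¹, X²)` and targets `(Z¹, Z²)`, and
`(R12', R21')` is admissible with `r₂` rounds for the problem with sources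
`((X¹,Z¹), (X²,Z²))` and targets `(Y¹, Y²)`, then `(R12 + R12', R21 + R21')` is
admissible with `r₁ + r₂` rounds for the problem with sources `(X¹, X²)` and targets
`(Y¹, Y²)`. -/
theorem concatenation
    {𝒵₁ 𝒵₂ : Type}
    [Fintype 𝒳₁] [DecidableEq 𝒳₁] [Fintype 𝒳₂] [DecidableEq 𝒳₂]
    [Fintype 𝒵₁] [DecidableEq 𝒵₁] [Fintype 𝒵₂] [DecidableEq 𝒵₂]
    [Fintype 𝒴₁] [DecidableEq 𝒴₁] [Fintype 𝒴₂] [DecidableEq 𝒴₂]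
    (q6 : 𝒳₁ × 𝒳₂ × 𝒵₁ × 𝒵₂ × 𝒴₁ × 𝒴₂ → ℝ) (hq : IsPMF q6)
    (r₁ r₂ : ℕ) (R12 R21 R12' R21' : ℝ)
    (h1 : Admissible (fun a : 𝒳₁ × 𝒳₂ × 𝒵₁ × 𝒵₂ =>
        ∑ y₁, ∑ y₂, q6 (a.1, a.2.1, a.2.2.1, a.2.2.2, y₁, y₂)) r₁ R12 R21)
    (h2 : Admissible (fun a : (𝒳₁ × 𝒵₁) × (𝒳₂ × 𝒵₂) × 𝒴₁ × 𝒴₂ =>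
        q6 (a.1.1, a.2.1.1, a.1.2, a.2.1.2, a.2.2.1, a.2.2.2)) r₂ R12' R21') :
    Admissible (fun a : 𝒳₁ × 𝒳₂ × 𝒴₁ × 𝒴₂ =>
        ∑ z₁, ∑ z₂, q6 (a.1, a.2.1, z₁, z₂, a.2.2.1, a.2.2.2))
      (r₁ + r₂) (R12 + R12') (R21 + R21') := by
  intro ε hε
  obtain ⟨δ, hδ, n₂, hn₂⟩ := h2.exists_robust hε
  obtain ⟨n₁, hn₁⟩ := h1 δ hδ
  refine ⟨max n₁ n₂, fun n hn => ?_⟩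
  obtain ⟨Ω, 𝓜₁, 𝓜₂, 𝓒, _, _, _, _, _, _, _, _, μ, X₁, X₂, M₁, M₂, C, Z₁, Z₂, hμ, hX, hind,
    hC₁, hC₂, hR₁, hR₂, hZ₁, hZ₂, hdist⟩ := hn₁ n ((le_max_left _ _).trans hn)
  rw [condEnt_eq_zero_iff hμ] at hZ₁ hZ₂
  let W : Ω → (Fin n → 𝒳₁ × 𝒵₁) × (Fin n → 𝒳₂ × 𝒵₂) :=
    fun ω => (fun k => (X₁ ω k, Z₁ ω k), fun k => (X₂ ω k, Z₂ ω k))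
  have hWd : l1dist (distr μ W) (fun x => ∏ k, srcMarg
      (fun a : (𝒳₁ × 𝒵₁) × (𝒳₂ × 𝒵₂) × 𝒴₁ × 𝒴₂ =>
        q6 (a.1.1, a.2.1.1, a.1.2, a.2.1.2, a.2.2.1, a.2.2.2)) (x.1 k, x.2 k)) ≤ δ := by
    rw [eq_distr_of_inverse (fun x : (Fin n → 𝒳₁ × 𝒵₁) × (Fin n → 𝒳₂ × 𝒵₂) => ∏ k, srcMarg
      (fun a : (𝒳₁ × 𝒵₁) × (𝒳₂ × 𝒵₂) × 𝒴₁ × 𝒴₂ =>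
        q6 (a.1.1, a.2.1.1, a.1.2, a.2.1.2, a.2.2.1, a.2.2.2)) (x.1 k, x.2 k))
      (e := fun v : (Fin n → 𝒳₁) × (Fin n → 𝒳₂) × (Fin n → 𝒵₁) × (Fin n → 𝒵₂) =>
        (fun k => (v.1 k, v.2.2.1 k), fun k => (v.2.1 k, v.2.2.2 k)))
      (e' := fun x => (fun k => (x.1 k).1, fun k => (x.2 k).1, fun k => (x.1 k).2,
        fun k => (x.2 k).2)) (fun _ => rfl) (fun _ => rfl),
      ← distr_distr μ (fun ω => (X₁ ω, X₂ ω, Z₁ ω, Z₂ ω))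
        (fun v : (Fin n → 𝒳₁) × (Fin n → 𝒳₂) × (Fin n → 𝒵₁) × (Fin n → 𝒵₂) =>
        ((fun k => (v.1 k, v.2.2.1 k), fun k => (v.2.1 k, v.2.2.2 k)) :
          (Fin n → 𝒳₁ × 𝒵₁) × (Fin n → 𝒳₂ × 𝒵₂)))]
    exact (l1dist_distr_le _ _ _).trans hdist
  obtain ⟨N₁, N₂, T, _, _, _, _, _, _, ν₁, ν₂, B, y₁, y₂, Q, hν₁, hν₂, hQ, hB, hy₁, hy₂, hB₁, hB₂,
    hBd⟩ := hn₂ n ((le_max_right _ _).trans hn) (distr μ W) (hμ.distr W) hWd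
  have hν := hν₁.prod hν₂
  let μ' : Ω × (N₁ × N₂) → ℝ := fun w => μ w.1 * (ν₁ w.2.1 * ν₂ w.2.2)
  have hμ' : IsPMF μ' := hμ.prod hν
  have hne : ∀ w, μ' w ≠ 0 → μ w.1 ≠ 0 := fun w hw => left_ne_zero_of_mul hw
  let loc : Ω × (N₁ × N₂) → ((Fin n → 𝒳₁ × 𝒵₁) × N₁) × ((Fin n → 𝒳₂ × 𝒵₂) × N₂) :=
    fun w => byNode (W w.1, w.2)
  have hQ' : Q = distr μ' fun w => (W w.1, w.2) := by
    have := distr_prodMap μ (fun m : N₁ × N₂ => ν₁ m.1 * ν₂ m.2) W fun m => m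
    rw [distr_id] at this
    exact hQ.trans this.symm
  let s := 2 * (r₁ / 2)
  have hs : s ≤ r₁ := Nat.mul_div_le r₁ 2
  have hs2 : s % 2 = 0 := Nat.mul_mod_right 2 _
  have hs1 : r₁ ≤ s + 1 := by lia
  let cA : ℕ → Ω → Option (Σ i : Fin r₁, 𝓒 i) :=
    fun i ω => if hi : i < r₁ then some ⟨⟨i, hi⟩, C ⟨i, hi⟩ ω⟩ else none
  let cB : ℕ → Ω × (N₁ × N₂) → Option T :=
    fun i w => if s ≤ i ∧ i - s < r₂ then some (B (i - s) (loc w)) else none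
  have hcA : ∀ (i : Fin r₁) ω, cA i ω = some ⟨i, C i ω⟩ := fun i ω => dif_pos i.2
  have hcA_iff : ∀ (i : Fin r₁) ω ω', cA i ω = cA i ω' ↔ C i ω = C i ω' := fun i ω ω' => by
    rw [hcA, hcA, Option.some_inj]
    simp
  have hcA_causal : ∀ i ω ω', μ ω ≠ 0 → μ ω' ≠ 0 → (∀ j < i, cA j ω = cA j ω') →
      (i % 2 = 0 → X₁ ω = X₁ ω' ∧ M₁ ω = M₁ ω') → (i % 2 = 1 → X₂ ω = X₂ ω' ∧ M₂ ω = M₂ ω') →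
      cA i ω = cA i ω' := by
    intro i ω ω' hω hω' hpre he ho
    by_cases hi : i < r₁
    · refine (hcA_iff ⟨i, hi⟩ ω ω').2 ?_
      have hpre' : (fun j : Fin i => C ⟨j.1, j.2.trans hi⟩ ω) =
          fun j : Fin i => C ⟨j.1, j.2.trans hi⟩ ω' :=
        funext fun j => (hcA_iff ⟨j.1, j.2.trans hi⟩ _ _).1 (hpre j j.2)
      rcases Nat.mod_two_eq_zero_or_one i with hpar | hpar
      · exact (condEnt_eq_zero_iff hμ _ _).1 (hC₁ ⟨i, hi⟩ hpar) ω ω' hω hω'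
          (Prod.ext hpre' (Prod.ext (he hpar).1 (he hpar).2))
      · exact (condEnt_eq_zero_iff hμ _ _).1 (hC₂ ⟨i, hi⟩ hpar) ω ω' hω hω'
          (Prod.ext hpre' (Prod.ext (ho hpar).1 (ho hpar).2))
    · simp only [cA, dif_neg hi]
  have hCall : ∀ ω ω', (∀ j < r₁, cA j ω = cA j ω') →
      (fun i : Fin r₁ => C i ω) = fun i => C i ω' := fun ω ω' h =>
    funext fun i => (hcA_iff i _ _).1 (h i i.2)
  have hloc₁ : ∀ w w', μ' w ≠ 0 → μ' w' ≠ 0 → (∀ j < r₁, cA j w.1 = cA j w'.1) →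
      X₁ w.1 = X₁ w'.1 → M₁ w.1 = M₁ w'.1 → w.2.1 = w'.2.1 → (loc w).1 = (loc w').1 := by
    intro w w' hw hw' hA hXe hMe hNe
    have hZe : Z₁ w.1 = Z₁ w'.1 :=
      hZ₁ w.1 w'.1 (hne w hw) (hne w' hw') (Prod.ext hXe (Prod.ext hMe (hCall _ _ hA)))
    simp only [loc, byNode, W, hXe, hZe, hNe]
  have hloc₂ : ∀ w w', μ' w ≠ 0 → μ' w' ≠ 0 → (∀ j < r₁, cA j w.1 = cA j w'.1) →
      X₂ w.1 = X₂ w'.1 → M₂ w.1 = M₂ w'.1 → w.2.2 = w'.2.2 → (loc w).2 = (loc w').2 := by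
    intro w w' hw hw' hA hXe hMe hNe
    have hZe : Z₂ w.1 = Z₂ w'.1 :=
      hZ₂ w.1 w'.1 (hne w hw) (hne w' hw') (Prod.ext hXe (Prod.ext hMe (hCall _ _ hA)))
    simp only [loc, byNode, W, hXe, hZe, hNe]
  have hcB : ∀ j < r₂, ∀ w, cB (j + s) w = some (B j (loc w)) := fun j hj w => by
    simp only [cB, Nat.add_sub_cancel]
    exact if_pos ⟨Nat.le_add_left s j, hj⟩
  have hcausal : ∀ i w w', μ' w ≠ 0 → μ' w' ≠ 0 →
      (∀ j < i, (cA j w.1, cB j w) = (cA j w'.1, cB j w')) →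
      (i % 2 = 0 → X₁ w.1 = X₁ w'.1 ∧ M₁ w.1 = M₁ w'.1 ∧ w.2.1 = w'.2.1) →
      (i % 2 = 1 → X₂ w.1 = X₂ w'.1 ∧ M₂ w.1 = M₂ w'.1 ∧ w.2.2 = w'.2.2) →
      (cA i w.1, cB i w) = (cA i w'.1, cB i w') := by
    intro i w w' hw hw' hpre he ho
    have hpreA : ∀ j < i, cA j w.1 = cA j w'.1 := fun j hj => (Prod.ext_iff.1 (hpre j hj)).1
    have hAi : cA i w.1 = cA i w'.1 := hcA_causal i _ _ (hne w hw) (hne w' hw') hpreA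
      (fun h => ⟨(he h).1, (he h).2.1⟩) (fun h => ⟨(ho h).1, (ho h).2.1⟩)
    refine Prod.ext hAi ?_
    by_cases hi : s ≤ i ∧ i - s < r₂
    · have hA : ∀ j < r₁, cA j w.1 = cA j w'.1 := fun j hj => by
        rcases (show j ≤ i by lia).lt_or_eq with hji | rfl
        exacts [hpreA j hji, hAi]
      simp only [cB, if_pos hi]
      congr 1
      refine hB (i - s) _ _ (fun j hj => ?_) (fun hpar => ?_) (fun hpar => ?_)
      · have := (Prod.ext_iff.1 (hpre (j + s) (by lia))).2
        simp only [hcB j (hj.trans hi.2)] at this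
        exact Option.some_injective _ this
      · obtain ⟨h1, h2, h3⟩ := he (by lia)
        exact hloc₁ w w' hw hw' hA h1 h2 h3
      · obtain ⟨h1, h2, h3⟩ := ho (by lia)
        exact hloc₂ w w' hw hw' hA h1 h2 h3
    · simp only [cB, if_neg hi]
  have hout : ∀ w w', (∀ i : Fin (r₁ + r₂), (cA i w.1, cB i w) = (cA i w'.1, cB i w')) →
      (∀ j < r₁, cA j w.1 = cA j w'.1) ∧ ∀ j < r₂, B j (loc w) = B j (loc w') := by
    refine fun w w' h => ⟨fun j hj => (Prod.ext_iff.1 (h ⟨j, by lia⟩)).1, fun j hj => ?_⟩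
    have := (Prod.ext_iff.1 (h ⟨j + s, by lia⟩)).2
    simp only [hcB j hj] at this
    exact Option.some_injective _ this
  have hHA : ∀ i, H μ' (fun w => cA i w.1) =
      if i < r₁ then H μ (cA i) else 0 := fun i => by
    split_ifs with hi
    · rw [H, H]
      exact congrArg entFun (distr_fst μ hν (cA i))
    · simp only [cA, dif_neg hi]
      exact H_const hμ' _
  have hHC : ∀ i : Fin r₁, H μ (cA i) = H μ (C i) := fun i => by
    rw [show cA i = fun ω => (fun x : 𝓒 i => (some ⟨i, x⟩ : Option (Σ i : Fin r₁, 𝓒 i))) (C i ω)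
      from funext (hcA i)]
    exact H_comp_injective μ (C i) (e := fun x : 𝓒 i => (some ⟨i, x⟩ : Option (Σ i, 𝓒 i)))
      fun x y hxy => by simpa using hxy
  have hHB : ∀ i, H μ' (cB i) =
      if s ≤ i ∧ i - s < r₂ then H Q (fun w => B (i - s) (byNode w)) else 0 := fun i => by
    by_cases hi : s ≤ i ∧ i - s < r₂
    · simp only [cB, if_pos hi]
      rw [hQ', H_distr]
      exact H_comp_injective μ' (fun w => B (i - s) (loc w)) (Option.some_injective T)
    · simp only [cB, if_neg hi]
      exact H_const hμ' _
  have hrate : ∀ b R R',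
      ∑ i ∈ Finset.univ.filter (fun i : Fin r₁ => (i : ℕ) % 2 = b), H μ (C i) ≤ n * R →
      ∑ i ∈ Finset.range r₂ with i % 2 = b, H Q (fun w => B i (byNode w)) ≤ n * R' →
      ∑ i ∈ Finset.univ.filter (fun i : Fin (r₁ + r₂) => (i : ℕ) % 2 = b),
        H μ' (fun w => (cA i w.1, cB i w)) ≤ n * (R + R') := by
    intro b R R' hR hR'
    calc _ ≤ ∑ i ∈ Finset.univ.filter (fun i : Fin (r₁ + r₂) => (i : ℕ) % 2 = b),
          (H μ' (fun w => cA i w.1) + H μ' (cB i)) :=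
          Finset.sum_le_sum fun i _ => H_pair_le hμ' _ _
      _ = ∑ i ∈ Finset.range (r₁ + r₂) with i % 2 = b, H μ' (fun w => cA i w.1) +
          ∑ i ∈ Finset.range (r₁ + r₂) with i % 2 = b, H μ' (cB i) := by
          rw [sum_filter_fin_eq_sum_range _ b fun i => H μ' (fun w => cA i w.1) + H μ' (cB i),
            Finset.sum_add_distrib]
      _ = ∑ i ∈ Finset.univ.filter (fun i : Fin r₁ => (i : ℕ) % 2 = b), H μ (C i) +
          ∑ i ∈ Finset.range r₂ with i % 2 = b, H Q (fun w => B i (byNode w)) := by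
          simp only [hHA, hHB]
          rw [sum_filter_range_add r₁ r₂ b fun i => H μ (cA i),
            sum_filter_range_shift hs hs2 b fun i => H Q (fun w => B i (byNode w)),
            ← sum_filter_fin_eq_sum_range]
          simp only [hHC]
      _ ≤ n * (R + R') := by linarith
  have hsrc : distr μ' (fun w => (X₁ w.1, X₂ w.1)) = distr μ (fun ω => (X₁ ω, X₂ ω)) :=
    distr_fst μ hν fun ω => (X₁ ω, X₂ ω)
  refine ⟨Ω × (N₁ × N₂), 𝓜₁ × N₁, 𝓜₂ × N₂, fun _ => Option (Σ i : Fin r₁, 𝓒 i) × Option T,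
    inferInstance, inferInstance, inferInstance, inferInstance, inferInstance, inferInstance,
    inferInstance, inferInstance, μ', fun w => X₁ w.1, fun w => X₂ w.1,
    fun w => (M₁ w.1, w.2.1), fun w => (M₂ w.1, w.2.2), fun i w => (cA i w.1, cB i w),
    fun w => y₁ (loc w), fun w => y₂ (loc w), hμ', ?_, ?_, fun i hi => ?_, fun i hi => ?_,
    hrate 0 R12 R12' hR₁ hB₁, hrate 1 R21 R21' hR₂ hB₂, ?_, ?_, ?_⟩
  · rw [hsrc, hX]
    funext x
    refine Finset.prod_congr rfl fun k _ => ?_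
    simp only [srcMarg]
    calc _ = ∑ z : 𝒵₁ × 𝒵₂, ∑ y : 𝒴₁ × 𝒴₂, q6 (x.1 k, x.2 k, z.1, z.2, y.1, y.2) := by
          simp only [Fintype.sum_prod_type]
      _ = _ := by
          rw [Finset.sum_comm]
          simp only [Fintype.sum_prod_type]
  · funext ⟨⟨a₁, b₁⟩, ⟨a₂, b₂⟩, x⟩
    rw [hsrc]
    have hprod := congrFun (distr_prodMap μ (fun m : N₁ × N₂ => ν₁ m.1 * ν₂ m.2)
      (fun ω => (M₁ ω, M₂ ω, X₁ ω, X₂ ω)) fun m => m) ((a₁, a₂, x), (b₁, b₂))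
    have hprod₁ := congrFun (distr_prodMap μ (fun m : N₁ × N₂ => ν₁ m.1 * ν₂ m.2) M₁
      fun m => m.1) (a₁, b₁)
    have hprod₂ := congrFun (distr_prodMap μ (fun m : N₁ × N₂ => ν₁ m.1 * ν₂ m.2) M₂
      fun m => m.2) (a₂, b₂)
    rw [distr_id, hind] at hprod
    rw [distr_fst ν₁ hν₂ fun m => m, distr_id] at hprod₁
    rw [distr_snd hν₁ ν₂ fun m => m, distr_id] at hprod₂
    have hinj := distr_comp_injective μ' (fun w => ((M₁ w.1, M₂ w.1, X₁ w.1, X₂ w.1), w.2))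
      (e := fun v => ((v.1.1, v.2.1), (v.1.2.1, v.2.2), v.1.2.2))
      (by
        rintro ⟨⟨a, b, c⟩, d, e⟩ ⟨⟨a', b', c'⟩, d', e'⟩ hh
        simp only [Prod.mk.injEq] at hh ⊢
        tauto) ((a₁, a₂, x), (b₁, b₂))
    calc _ = _ := hinj
      _ = _ := hprod
      _ = (distr μ M₁ a₁ * ν₁ b₁) * (distr μ M₂ a₂ * ν₂ b₂) *
          distr μ (fun ω => (X₁ ω, X₂ ω)) x := by ring
      _ = _ := by
        rw [← hprod₁, ← hprod₂]
  · refine (condEnt_eq_zero_iff hμ' _ _).2 fun w w' hw hw' hh => ?_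
    simp only [Prod.mk.injEq] at hh
    exact hcausal i w w' hw hw' (fun j hj => congrFun hh.1 ⟨j, hj⟩)
      (fun _ => ⟨hh.2.1, hh.2.2.1, hh.2.2.2⟩) (fun h => by lia)
  · refine (condEnt_eq_zero_iff hμ' _ _).2 fun w w' hw hw' hh => ?_
    simp only [Prod.mk.injEq] at hh
    exact hcausal i w w' hw hw' (fun j hj => congrFun hh.1 ⟨j, hj⟩)
      (fun h => by lia) (fun _ => ⟨hh.2.1, hh.2.2.1, hh.2.2.2⟩)
  · refine (condEnt_eq_zero_iff hμ' _ _).2 fun w w' hw hw' hh => ?_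
    simp only [Prod.mk.injEq] at hh
    obtain ⟨hXe, ⟨hMe, hNe⟩, hmsg⟩ := hh
    obtain ⟨hA, hBe⟩ := hout w w' (congrFun hmsg)
    exact hy₁ _ _ hBe (hloc₁ w w' hw hw' hA hXe hMe hNe)
  · refine (condEnt_eq_zero_iff hμ' _ _).2 fun w w' hw hw' hh => ?_
    simp only [Prod.mk.injEq] at hh
    obtain ⟨hXe, ⟨hMe, hNe⟩, hmsg⟩ := hh
    obtain ⟨hA, hBe⟩ := hout w w' (congrFun hmsg)
    exact hy₂ _ _ hBe (hloc₂ w w' hw hw' hA hXe hMe hNe)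
  · have hproj := l1dist_distr_le _ _
      (fun a : (Fin n → 𝒳₁ × 𝒵₁) × (Fin n → 𝒳₂ × 𝒵₂) × (Fin n → 𝒴₁) × (Fin n → 𝒴₂) =>
        ((fun k => (a.1 k).1 : Fin n → 𝒳₁), (fun k => (a.2.1 k).1 : Fin n → 𝒳₂),
          a.2.2.1, a.2.2.2)) |>.trans hBd
    rw [distr_distr, hQ', distr_distr, distr_prod_quadruple
      (fun a : (𝒳₁ × 𝒵₁) × (𝒳₂ × 𝒵₂) × 𝒴₁ × 𝒴₂ =>
        q6 (a.1.1, a.2.1.1, a.1.2, a.2.1.2, a.2.2.1, a.2.2.2)) Prod.fst Prod.fst] at hproj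
    simp only [distr_fst_fst_quadruple] at hproj
    exact hproj

end Coord
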